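/- arXiv:1103.2894 — 12 statements merged into one kernel-verified Lean document; each statement's English description precedes it below -/
import Mathlib

section
/- Let $0<\lambda<1/2$ and let $\mu\in\mathbb{C}$ satisfy $0<\operatorname{Re}\mu<\lambda$. Then the identity $\int_0^1 y^{-2\lambda}\int_{1-y}^{\infty}(yz)^{\lambda}z^{-(1+2\lambda)+\mu}\,dz\,dy \;+\; \int_0^1 y^{-2\lambda+\mu}\int_{1-y}^{\infty}(yz)^{\lambda}z^{-(1+2\lambda)}\,dz\,dy \;=\; \frac{B(1-\lambda,1-\lambda)}{\lambda}$ holds if and only if $\Psi_\lambda(\mu):=(\lambda-\mu)B(1-\lambda,1-\lambda)-(2\lambda-\mu)B(1-\lambda,1-\lambda+\mu)=0$. -/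
open MeasureTheory Complex

/-- The Beta function for complex arguments, `B(p,q) = Γ(p)Γ(q)/Γ(p+q)`. -/
noncomputable def cBeta (p q : ℂ) : ℂ :=
  Complex.Gamma p * Complex.Gamma q / Complex.Gamma (p + q)

/-- The characteristic function
`Ψ_λ(μ) = (λ-μ) B(1-λ,1-λ) - (2λ-μ) B(1-λ,1-λ+μ)`. -/
noncomputable def Psi (l : ℝ) (μ : ℂ) : ℂ :=
  ((l:ℂ) - μ) * cBeta (1 - l) (1 - l) - (2*(l:ℂ) - μ) * cBeta (1 - l) (1 - l + μ)

/-- Beta integrals agree with `cBeta` on the half-plane of convergence. -/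
theorem betaIntegral_eq_cBeta {p q : ℂ} (hp : 0 < p.re) (hq : 0 < q.re) :
    betaIntegral p q = cBeta p q := by
  have hpq : 0 < (p + q).re := by rw [add_re]; exact add_pos hp hq
  rw [cBeta, Gamma_mul_Gamma_eq_betaIntegral hp hq,
    mul_div_cancel_left₀ _ (Gamma_ne_zero_of_re_pos hpq)]

theorem cBeta_comm (p q : ℂ) : cBeta p q = cBeta q p := by
  rw [cBeta, cBeta, mul_comm, add_comm]

theorem integral_Ioi_mul_cpow_mul_cpow {y c : ℝ} (hy : 0 ≤ y) (hc : 0 < c) {s b : ℂ}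
    (hsb : (s + b).re < -1) :
    ∫ z in Set.Ioi c, ((y:ℂ) * (z:ℂ)) ^ s * (z:ℂ) ^ b
      = (y:ℂ) ^ s * (-(c:ℂ) ^ (s + b + 1) / (s + b + 1)) := by
  rw [← integral_Ioi_cpow_of_lt hsb hc, ← integral_const_mul]
  refine setIntegral_congr_fun measurableSet_Ioi fun z hz => ?_
  have hz : 0 < z := hc.trans hz
  have hz' : (z:ℂ) ≠ 0 := ofReal_ne_zero.mpr hz.ne'
  simp only [mul_cpow_ofReal_nonneg hy hz.le, cpow_add _ _ hz', mul_assoc]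

theorem integral_Ioo_cpow_mul_integral_Ioi {s a b : ℂ} (hsb : (s + b).re < -1) :
    ∫ y in Set.Ioo (0:ℝ) 1, (y:ℂ) ^ a *
        ∫ z in Set.Ioi (1 - y), ((y:ℂ) * (z:ℂ)) ^ s * (z:ℂ) ^ b
      = -betaIntegral (a + s + 1) (s + b + 2) / (s + b + 1) := by
  rw [betaIntegral, intervalIntegral.integral_of_le zero_le_one, integral_Ioc_eq_integral_Ioo,
    ← integral_neg, ← integral_div]
  refine setIntegral_congr_fun measurableSet_Ioo fun y hy => ?_
  have hy' : (y:ℂ) ≠ 0 := ofReal_ne_zero.mpr hy.1.ne'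
  have h₁ : a + s + 1 - 1 = a + s := by ring
  have h₂ : s + b + 2 - 1 = s + b + 1 := by ring
  simp only [integral_Ioi_mul_cpow_mul_cpow hy.1.le (sub_pos.mpr hy.2) hsb, h₁, h₂,
    cpow_add _ _ hy', ofReal_sub, ofReal_one]
  ring

/-- For `0 < λ < 1/2` and `μ ∈ ℂ` with `0 < Re μ < λ`, the identity
`∫_0^1 y^(-2λ) ∫_{1-y}^∞ (yz)^λ z^(-(1+2λ)+μ) dz dy
  + ∫_0^1 y^(-2λ+μ) ∫_{1-y}^∞ (yz)^λ z^(-(1+2λ)) dz dy = B(1-λ,1-λ)/λ`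
holds if and only if `Ψ_λ(μ) = 0`. -/
theorem eigenvalue_equation_iff_Psi_eq_zero (l : ℝ) (μ : ℂ)
    (hl : 0 < l) (hl' : l < 1/2) (hμ₁ : 0 < μ.re) (hμ₂ : μ.re < l) :
    ((∫ y in Set.Ioo (0:ℝ) 1, (y:ℂ) ^ (-(2*(l:ℂ))) *
        ∫ z in Set.Ioi (1 - y), ((y:ℂ)*(z:ℂ)) ^ (l:ℂ) * (z:ℂ) ^ (-(1 + 2*(l:ℂ)) + μ))
      + (∫ y in Set.Ioo (0:ℝ) 1, (y:ℂ) ^ (-(2*(l:ℂ)) + μ) *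
        ∫ z in Set.Ioi (1 - y), ((y:ℂ)*(z:ℂ)) ^ (l:ℂ) * (z:ℂ) ^ (-(1 + 2*(l:ℂ))))
      = cBeta (1 - l) (1 - l) / (l:ℂ))
    ↔ Psi l μ = 0 := by
  have hl₀ : (l:ℂ) ≠ 0 := ofReal_ne_zero.mpr hl.ne'
  have hlμ : (l:ℂ) - μ ≠ 0 := fun h => by
    have := congrArg re h
    simp only [sub_re, ofReal_re, zero_re] at this
    linarith
  have h₁ : 0 < (1 - (l:ℂ)).re := by
    simp only [sub_re, one_re, ofReal_re]
    linarith
  have h₂ : 0 < (1 - (l:ℂ) + μ).re := by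
    rw [add_re]
    linarith
  have e₁ : (l:ℂ) + (-(1 + 2*(l:ℂ)) + μ) = μ - l - 1 := by ring
  have e₂ : (l:ℂ) + -(1 + 2*(l:ℂ)) = -l - 1 := by ring
  rw [integral_Ioo_cpow_mul_integral_Ioi, integral_Ioo_cpow_mul_integral_Ioi, e₁, e₂,
    show -(2*(l:ℂ)) + l + 1 = 1 - l by ring, show μ - l - 1 + 2 = 1 - l + μ by ring,
    show -(2*(l:ℂ)) + μ + l + 1 = 1 - l + μ by ring, show -(l:ℂ) - 1 + 2 = 1 - l by ring,
    show μ - l - 1 + 1 = -(l - μ) by ring, show -(l:ℂ) - 1 + 1 = -l by ring,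
    neg_div_neg_eq, neg_div_neg_eq, betaIntegral_eq_cBeta h₁ h₂, betaIntegral_eq_cBeta h₂ h₁,
    cBeta_comm (1 - l + μ), Psi, div_add_div _ _ hlμ hl₀, div_eq_div_iff (mul_ne_zero hlμ hl₀) hl₀,
    ← sub_eq_zero]
  · constructor
    · intro h
      refine (mul_eq_zero.mp ?_).resolve_left hl₀
      linear_combination -h
    · intro h
      linear_combination -(l:ℂ) * h
  · rw [e₂]
    simp only [sub_re, neg_re, one_re, ofReal_re]
    linarith
  · rw [e₁]
    simp only [sub_re, one_re, ofReal_re]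
    linarith
end

section
/- There exist $\lambda_0>0$ and $C>0$ such that for every $0<\lambda<\lambda_0$ the function $\Psi_\lambda(\mu)=(\lambda-\mu)B(1-\lambda,1-\lambda)-(2\lambda-\mu)B(1-\lambda,1-\lambda+\mu)$ has a root $\mu\in\mathbb{C}$ with $\operatorname{Re}\mu>0$, $\operatorname{Im}\mu>0$ and $\big|\mu-\big(\tfrac{\lambda}{2}+i\sqrt{\lambda}\big)\big|\le C\lambda^{3/2}$. -/
open Complex

open Metric Filter Topology

/-- A holomorphic function whose value at the centre of a disk is small compared to its variation
on the boundary circle has a zero in the disk. -/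
theorem exists_zero_mem_closedBall {f : ℂ → ℂ} {U : Set ℂ} {z₀ : ℂ} {r ε : ℝ}
    (hU : IsOpen U) (hconn : IsPreconnected U) (hf : DifferentiableOn ℂ f U)
    (hsub : closedBall z₀ r ⊆ U) (hr : 0 < r) (hsphere : ∀ z ∈ sphere z₀ r, ε ≤ ‖f z - f z₀‖)
    (hz₀ : ‖f z₀‖ < ε / 2) : ∃ z ∈ closedBall z₀ r, f z = 0 := by
  have hε : 0 < ε := by linarith [norm_nonneg (f z₀)]
  have hdiff : DiffContOnCl ℂ f (ball z₀ r) :=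
    DifferentiableOn.diffContOnCl ((hf.mono hsub).mono closure_ball_subset_closedBall)
  have hz₀U : z₀ ∈ U := hsub (mem_closedBall_self hr.le)
  have hne : ∃ᶠ z in 𝓝 z₀, f z ≠ f z₀ := by
    intro hev
    have hev' : f =ᶠ[𝓝 z₀] fun _ => f z₀ := by
      filter_upwards [hev] with z hz using not_not.1 hz
    have heq := (hf.analyticOnNhd hU).eqOn_of_preconnected_of_eventuallyEq
      analyticOnNhd_const hconn hz₀U hev'
    obtain ⟨z, hz⟩ := NormedSpace.sphere_nonempty (x := z₀) |>.2 hr.le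
    have h := hsphere z hz
    rw [heq (hsub (sphere_subset_closedBall hz))] at h
    simp only [sub_self, norm_zero] at h
    linarith
  obtain ⟨z, hz, hfz⟩ := hdiff.ball_subset_image_closedBall hr hsphere hne
    (show (0 : ℂ) ∈ ball (f z₀) (ε / 2) by simpa [dist_eq_norm] using hz₀)
  exact ⟨z, hz, hfz⟩

/-- The ratio `B(1-l,1-l) / B(1-l,1-l+μ)`. -/
noncomputable def betaRatio (p : ℂ × ℂ) : ℂ :=
  Gamma (1 - p.1) * Gamma (2 - 2 * p.1 + p.2) / (Gamma (2 - 2 * p.1) * Gamma (1 - p.1 + p.2))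

theorem contDiffAt_Gamma_of_re_pos {s : ℂ} (hs : 0 < s.re) {n : WithTop ℕ∞} :
    ContDiffAt ℂ n Gamma s := by
  have hopen : IsOpen {s : ℂ | 0 < s.re} := isOpen_lt continuous_const continuous_re
  have hd : DifferentiableOn ℂ Gamma {s : ℂ | 0 < s.re} := fun z hz =>
    (differentiableAt_Gamma z fun m hm => by
      have hz' : 0 < z.re := hz
      rw [hm] at hz'
      have : (0 : ℝ) ≤ m := m.cast_nonneg
      simp at hz'
      linarith).differentiableWithinAt
  exact (hd.analyticAt (hopen.mem_nhds hs)).contDiffAt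

theorem contDiffAt_betaRatio : ContDiffAt ℂ 1 betaRatio (0, 0) := by
  unfold betaRatio
  refine ContDiffAt.div (ContDiffAt.mul ?_ ?_) (ContDiffAt.mul ?_ ?_) ?_
  · exact ContDiffAt.comp (g := Gamma) (0, 0) (contDiffAt_Gamma_of_re_pos (by simp)) (by fun_prop)
  · exact ContDiffAt.comp (g := Gamma) (0, 0) (contDiffAt_Gamma_of_re_pos (by simp)) (by fun_prop)
  · exact ContDiffAt.comp (g := Gamma) (0, 0) (contDiffAt_Gamma_of_re_pos (by simp)) (by fun_prop)
  · exact ContDiffAt.comp (g := Gamma) (0, 0) (contDiffAt_Gamma_of_re_pos (by simp)) (by fun_prop)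
  · exact mul_ne_zero (Gamma_ne_zero_of_re_pos (by simp)) (Gamma_ne_zero_of_re_pos (by simp))

theorem betaRatio_zero_left {μ : ℂ} (hμ : ‖μ‖ < 1) : betaRatio (0, μ) = 1 + μ := by
  have hre : 0 < (1 + μ).re := by
    have := (abs_le.1 (abs_re_le_norm μ)).1
    simp
    linarith
  have hne : (1 + μ) ≠ 0 := fun h => by simp [h] at hre
  have hG := Gamma_ne_zero_of_re_pos hre
  have h2 : Gamma 2 = 1 := by simp
  have hadd : (2 : ℂ) + μ = (1 + μ) + 1 := by ring
  simp only [betaRatio, sub_zero, mul_zero, Gamma_one, h2, one_mul]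
  rw [hadd, Gamma_add_one _ hne]
  field_simp

theorem betaRatio_zero_right {l : ℂ} (hl : l.re < 1) : betaRatio (l, 0) = 1 := by
  have h1 : Gamma (1 - l) ≠ 0 := Gamma_ne_zero_of_re_pos (by simpa using hl)
  have h2 : Gamma (2 - 2 * l) ≠ 0 := Gamma_ne_zero_of_re_pos (by simp; linarith)
  simp only [betaRatio, add_zero]
  rw [mul_comm, div_self (mul_ne_zero h2 h1)]

/-- Near the origin, `betaRatio (l, μ) = 1 + μ + O(l μ)`, holomorphically in `μ`. -/
theorem exists_norm_betaRatio_sub_le : ∃ K > (0 : ℝ), ∃ δ > (0 : ℝ), ∀ l : ℂ, ‖l‖ < δ →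
    DifferentiableOn ℂ (fun μ => betaRatio (l, μ)) (ball 0 δ) ∧
      ∀ μ ∈ ball (0 : ℂ) δ, ‖betaRatio (l, μ) - 1 - μ‖ ≤ K * ‖l‖ * ‖μ‖ := by
  have hc : ContDiffAt ℂ 1 (fun p : ℂ × ℂ => betaRatio p - 1 - p.2) (0, 0) :=
    (contDiffAt_betaRatio.sub contDiffAt_const).sub contDiffAt_snd
  obtain ⟨K, t, ht, hlip⟩ := hc.exists_lipschitzOnWith
  have hev : ∀ᶠ p in 𝓝 ((0, 0) : ℂ × ℂ), p ∈ t ∧ ContDiffAt ℂ 1 betaRatio p :=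
    (eventually_mem_set.2 ht).and (contDiffAt_betaRatio.eventually (by simp))
  obtain ⟨δ', hδ', hball⟩ := Metric.eventually_nhds_iff.1 hev
  obtain ⟨δ, hδ, hδδ', hδ1⟩ : ∃ δ > 0, δ ≤ δ' ∧ δ ≤ 1 :=
    ⟨min δ' 1, lt_min hδ' one_pos, min_le_left _ _, min_le_right _ _⟩
  have hmem : ∀ l μ : ℂ, ‖l‖ < δ → ‖μ‖ < δ → (l, μ) ∈ t ∧ ContDiffAt ℂ 1 betaRatio (l, μ) :=
    fun l μ hl hμ => hball (by
      rw [dist_eq_norm]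
      simpa [Prod.norm_def] using ⟨hl.trans_le hδδ', hμ.trans_le hδδ'⟩)
  refine ⟨(K + 1) / δ, by positivity, δ, hδ, fun l hl => ?_⟩
  have hd : DifferentiableOn ℂ (fun μ => betaRatio (l, μ)) (ball 0 δ) := fun μ hμ =>
    (DifferentiableAt.comp (g := betaRatio) (f := fun μ : ℂ => (l, μ)) μ
      ((hmem l μ hl (mem_ball_zero_iff.1 hμ)).2.differentiableAt one_ne_zero)
      (by fun_prop)).differentiableWithinAt
  have hl1 : l.re < 1 := (re_le_norm l).trans_lt (hl.trans_le hδ1)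
  refine ⟨hd, fun μ hμ => ?_⟩
  have hbound : ∀ z ∈ ball (0 : ℂ) δ, ‖betaRatio (l, z) - 1 - z‖ ≤ (K + 1) * ‖l‖ := by
    intro z hz
    rw [mem_ball_zero_iff] at hz
    have h := hlip.dist_le_mul _ (hmem l z hl hz).1 _ (hmem 0 z (by simpa using hδ) hz).1
    simp only [betaRatio_zero_left (hz.trans_le hδ1), dist_eq_norm] at h
    simp [Prod.norm_def] at h
    linarith [norm_nonneg l]
  have hmaps : Set.MapsTo (fun z => betaRatio (l, z) - 1 - z) (ball 0 δ)
      (closedBall ((fun z => betaRatio (l, z) - 1 - z) 0) ((K + 1) * ‖l‖)) := by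
    intro z hz
    simpa [betaRatio_zero_right hl1] using hbound z hz
  have h := dist_le_div_mul_dist_of_mapsTo_ball
    ((hd.sub_const 1).fun_sub differentiableOn_id) hmaps hμ
  simp only [betaRatio_zero_right hl1, dist_eq_norm, sub_self, sub_zero, id] at h
  calc _ ≤ _ := h
    _ = _ := by ring

theorem Psi_eq_zero_of_betaRatio {l : ℝ} {μ : ℂ} (hl : l < 1 / 2) (hμ : 0 < μ.re)
    (h : ((l : ℂ) - μ) * betaRatio (l, μ) = 2 * l - μ) : Psi l μ = 0 := by
  have h1 : Gamma (1 - l) ≠ 0 := Gamma_ne_zero_of_re_pos (by simp; linarith)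
  have h2 : Gamma (2 - 2 * l) ≠ 0 := Gamma_ne_zero_of_re_pos (by simp; linarith)
  have h3 : Gamma (1 - l + μ) ≠ 0 := Gamma_ne_zero_of_re_pos (by simp; linarith)
  have h4 : Gamma (2 - 2 * l + μ) ≠ 0 := Gamma_ne_zero_of_re_pos (by simp; linarith)
  have e1 : (1 - l + (1 - l) : ℂ) = 2 - 2 * l := by ring
  have e2 : (1 - l + (1 - l + μ) : ℂ) = 2 - 2 * l + μ := by ring
  rw [Psi, cBeta, cBeta, e1, e2, ← h, betaRatio]
  generalize Gamma (2 - 2 * (l : ℂ)) = b at *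
  generalize Gamma (2 - 2 * (l : ℂ) + μ) = d at *
  field_simp
  ring

/-- If `D` is a holomorphic perturbation with `‖D μ‖ ≤ K s² ‖μ‖` near `0`, then
`(s² - μ) (1 + μ + D μ) = 2 s² - μ` has a solution within `O(s³)` of `s² / 2 + s i`. -/
theorem exists_root_near {K δ s : ℝ} {D : ℂ → ℂ} (hK : 0 < K) (hs : 0 < s)
    (hCs : (1 + 24 * K) * s ≤ 1 / 2) (hsδ : 2 * s < δ) (hD : DifferentiableOn ℂ D (ball 0 δ))
    (hDle : ∀ μ ∈ ball (0 : ℂ) δ, ‖D μ‖ ≤ K * s ^ 2 * ‖μ‖) :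
    ∃ μ ∈ closedBall ((s : ℂ) ^ 2 / 2 + s * I) ((1 + 24 * K) * s ^ 3),
      ((s : ℂ) ^ 2 - μ) * (1 + μ + D μ) = 2 * (s : ℂ) ^ 2 - μ := by
  set r := (1 + 24 * K) * s ^ 3 with hr
  set z₀ : ℂ := (s : ℂ) ^ 2 / 2 + s * I with hz₀
  have hs1 : s ≤ 1 / 2 := by nlinarith [mul_pos hK hs]
  have hr0 : 0 < r := by positivity
  have hrs : r ≤ s ^ 2 / 2 := by
    calc r = ((1 + 24 * K) * s) * s ^ 2 := by rw [hr]; ring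
      _ ≤ 1 / 2 * s ^ 2 := by gcongr
      _ = _ := by ring
  have hss : s ^ 2 ≤ s / 2 := by nlinarith
  have hns : ‖(s : ℂ)‖ = s := by simp [abs_of_pos hs]
  have hz₀n : ‖z₀‖ ≤ s ^ 2 / 2 + s := by
    calc ‖z₀‖ ≤ ‖(s : ℂ) ^ 2 / 2‖ + ‖(s : ℂ) * I‖ := norm_add_le _ _
      _ = _ := by rw [norm_div, norm_pow, norm_mul, hns]; simp
  have hnorm : ∀ z ∈ closedBall z₀ r, ‖z‖ ≤ 2 * s := by
    intro z hz
    rw [mem_closedBall, dist_eq_norm] at hz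
    have := norm_le_norm_add_norm_sub' z z₀
    linarith
  have hsub : closedBall z₀ r ⊆ ball 0 δ := fun z hz =>
    mem_ball_zero_iff.2 ((hnorm z hz).trans_lt hsδ)
  have herr : ∀ z ∈ closedBall z₀ r, ‖((s : ℂ) ^ 2 - z) * D z‖ ≤ 6 * K * s ^ 4 := by
    intro z hz
    have h1 : ‖(s : ℂ) ^ 2 - z‖ ≤ 3 * s := by
      have := norm_sub_le ((s : ℂ) ^ 2) z
      rw [norm_pow, hns] at this
      linarith [hnorm z hz]
    have h2 : ‖D z‖ ≤ K * s ^ 2 * (2 * s) :=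
      (hDle z (hsub hz)).trans (by gcongr; exact hnorm z hz)
    rw [norm_mul]
    calc _ ≤ 3 * s * (K * s ^ 2 * (2 * s)) := by gcongr
      _ = _ := by ring
  set f : ℂ → ℂ := fun μ => ((s : ℂ) ^ 2 - μ) * (1 + μ + D μ) - (2 * (s : ℂ) ^ 2 - μ) with hf
  have hfD : DifferentiableOn ℂ f (ball 0 δ) := by
    intro z hz
    have := hD z hz
    fun_prop
  have hz₀mem : z₀ ∈ closedBall z₀ r := mem_closedBall_self hr0.le
  suffices h : ∃ z ∈ closedBall z₀ r, f z = 0 by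
    obtain ⟨z, hz, hfz⟩ := h
    exact ⟨z, hz, sub_eq_zero.1 hfz⟩
  refine exists_zero_mem_closedBall (ε := (1 + 12 * K) * s ^ 4)
    isOpen_ball (convex_ball _ _).isPreconnected hfD hsub hr0 (fun z hz => ?_) ?_
  · have hzc := sphere_subset_closedBall hz
    have hzr : ‖z - z₀‖ = r := by simpa [dist_eq_norm] using hz
    have hexp : f z - f z₀ = -((z - z₀) * (2 * s * I + (z - z₀)))
        + (((s : ℂ) ^ 2 - z) * D z - ((s : ℂ) ^ 2 - z₀) * D z₀) := by
      simp only [hf, hz₀]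
      ring
    have hlow : s ≤ ‖2 * s * I + (z - z₀)‖ := by
      have h := norm_sub_le_norm_add (2 * s * I : ℂ) (z - z₀)
      rw [hzr] at h
      simp only [norm_mul, hns, norm_I, Complex.norm_ofNat] at h
      linarith
    have hmain : (1 + 24 * K) * s ^ 4 ≤ ‖-((z - z₀) * (2 * s * I + (z - z₀)))‖ := by
      rw [norm_neg, norm_mul, hzr]
      calc _ = r * s := by rw [hr]; ring
        _ ≤ _ := by gcongr
    have hdiff := norm_sub_le (((s : ℂ) ^ 2 - z) * D z) (((s : ℂ) ^ 2 - z₀) * D z₀)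
    have htri := norm_sub_le_norm_add (-((z - z₀) * (2 * s * I + (z - z₀))))
      (((s : ℂ) ^ 2 - z) * D z - ((s : ℂ) ^ 2 - z₀) * D z₀)
    rw [hexp]
    linarith [herr z hzc, herr z₀ hz₀mem]
  · have hexp : f z₀ = (s : ℂ) ^ 4 / 4 + ((s : ℂ) ^ 2 - z₀) * D z₀ := by
      simp only [hf, hz₀]
      linear_combination (-(s : ℂ) ^ 2) * I_sq
    have htri := norm_add_le ((s : ℂ) ^ 4 / 4) (((s : ℂ) ^ 2 - z₀) * D z₀)
    rw [norm_div, norm_pow, hns, Complex.norm_ofNat] at htri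
    rw [hexp]
    have : 0 < s ^ 4 := by positivity
    linarith [herr z₀ hz₀mem]

/-- There exist `λ₀ > 0` and `C > 0` such that for every `0 < λ < λ₀` the function
`Ψ_λ` has a root `μ` with `Re μ > 0`, `Im μ > 0`, and
`|μ - (λ/2 + i √λ)| ≤ C λ^(3/2)`. -/
theorem Psi_has_root_near :
    ∃ lam₀ > (0:ℝ), ∃ C > (0:ℝ), ∀ l : ℝ, 0 < l → l < lam₀ →
      ∃ μ : ℂ, Psi l μ = 0 ∧ 0 < μ.re ∧ 0 < μ.im ∧
        ‖μ - ((l/2 : ℝ) + Real.sqrt l * Complex.I)‖ ≤ C * l ^ ((3:ℝ)/2) := by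
  obtain ⟨K, hK, δ, hδ, hratio⟩ := exists_norm_betaRatio_sub_le
  set a := min (1 / (2 * (1 + 24 * K))) (δ / 2) with ha
  have ha0 : 0 < a := by positivity
  refine ⟨a ^ 2, by positivity, 1 + 24 * K, by positivity, fun l hl hla => ?_⟩
  obtain ⟨s, hs, rfl⟩ : ∃ s : ℝ, 0 < s ∧ l = s ^ 2 :=
    ⟨√l, Real.sqrt_pos.2 hl, (Real.sq_sqrt hl.le).symm⟩
  have hsa : s < a := lt_of_pow_lt_pow_left₀ 2 ha0.le hla
  have hCs : (1 + 24 * K) * s < 1 / 2 := by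
    have h := hsa.trans_le (min_le_left _ _)
    rw [lt_div_iff₀ (by positivity)] at h
    linarith
  have hsδ : 2 * s < δ := by linarith [hsa.trans_le (min_le_right _ _)]
  have hs1 : s < 1 / 2 := by nlinarith [mul_pos hK hs]
  have hns : ‖((s ^ 2 : ℝ) : ℂ)‖ = s ^ 2 := by simp
  obtain ⟨hdiff, hle⟩ := hratio ((s ^ 2 : ℝ) : ℂ) (by rw [hns]; nlinarith)
  rw [hns] at hle
  obtain ⟨μ, hμ, hroot⟩ := exists_root_near
    (D := fun μ => betaRatio (((s ^ 2 : ℝ) : ℂ), μ) - 1 - μ) hK hs hCs.le hsδ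
    ((hdiff.sub_const 1).sub differentiableOn_id) hle
  rw [mem_closedBall, dist_eq_norm] at hμ
  have hr : (1 + 24 * K) * s ^ 3 < s ^ 2 / 2 := by
    have := mul_lt_mul_of_pos_right hCs (pow_pos hs 2)
    linarith
  have hre := (abs_le.1 ((abs_re_le_norm _).trans hμ)).1
  have him := (abs_le.1 ((abs_im_le_norm _).trans hμ)).1
  have e : (s : ℂ) ^ 2 / 2 + s * I = ((s ^ 2 / 2 : ℝ) : ℂ) + (s : ℝ) * I := by push_cast; ring
  rw [e] at hre him hμ
  simp only [sub_re, add_re, ofReal_re, mul_re, I_re, I_im, ofReal_im, sub_im, add_im, mul_im]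
    at hre him
  have hμre : 0 < μ.re := by linarith
  refine ⟨μ, Psi_eq_zero_of_betaRatio (by nlinarith) hμre ?_, hμre, by nlinarith, ?_⟩
  · push_cast at hroot ⊢
    rw [← hroot]
    ring
  · rw [Real.sqrt_sq hs.le, ← Real.rpow_natCast s 2, ← Real.rpow_mul hs.le]
    norm_num
    norm_num at hμ
    exact hμ
end

section
/- Let $(U_0,\omega_0):\mathbb{R}\to(0,\infty)\times\mathbb{R}$ be a nonconstant periodic solution of $\frac{dU_0}{d\xi}=U_0\omega_0$, $\frac{d\omega_0}{d\xi}=1-U_0$ with minimal period $T>0$ and energy $E=-\log U_0+(U_0-1)+\tfrac12\omega_0^2>0$. Then $\int_0^{T}\left[(U_0(\xi)-1)^2+\omega_0(\xi)^2\,(1-U_0(\xi))\right]d\xi \;=\; 2\int_0^{\sqrt{2E}}\big(U_+(E,\omega)-U_-(E,\omega)\big)\,d\omega.$ -/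
open MeasureTheory

/-- The function `log u - u` takes equal values at two distinct positive points only if
they lie strictly on either side of `1`. -/
lemma lt_one_and_one_lt_of_log_sub_self_eq {a b : ℝ} (hb : 0 < b) (hab : b < a)
    (h : Real.log a - a = Real.log b - b) : b < 1 ∧ 1 < a := by
  have ha : 0 < a := hb.trans hab
  have key : ∀ x y : ℝ, 0 < x → 0 < y → x ≠ y → (Real.log x - Real.log y) * y < x - y := by
    intro x y hx hy hxy
    have h1 := Real.log_lt_sub_one_of_pos (div_pos hx hy)
      (fun h => hxy ((div_eq_one_iff_eq hy.ne').1 h))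
    rw [Real.log_div hx.ne' hy.ne'] at h1
    calc (Real.log x - Real.log y) * y < (x / y - 1) * y := mul_lt_mul_of_pos_right h1 hy
      _ = x - y := by field_simp
  have h1 := key a b ha hb hab.ne'
  have h2 := key b a hb ha hab.ne
  constructor <;> nlinarith

lemma log_sub_self_injOn_Ici {a b : ℝ} (ha : 1 ≤ a) (hb : 1 ≤ b)
    (h : Real.log a - a = Real.log b - b) : a = b := by
  rcases lt_trichotomy a b with hab | hab | hab
  · linarith [(lt_one_and_one_lt_of_log_sub_self_eq (by linarith) hab h.symm).1]
  · exact hab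
  · linarith [(lt_one_and_one_lt_of_log_sub_self_eq (by linarith) hab h).1]

lemma log_sub_self_injOn_Ioc {a b : ℝ} (ha : 0 < a) (hb : 0 < b) (ha1 : a ≤ 1) (hb1 : b ≤ 1)
    (h : Real.log a - a = Real.log b - b) : a = b := by
  rcases lt_trichotomy a b with hab | hab | hab
  · linarith [(lt_one_and_one_lt_of_log_sub_self_eq ha hab h.symm).2]
  · exact hab
  · linarith [(lt_one_and_one_lt_of_log_sub_self_eq hb hab h).2]

/-- A periodic orbit of the system that returns to a value after a time `t - s` is
`(t - s)`-periodic. -/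
lemma periodic_sub_of_orbit_eq {U ω : ℝ → ℝ} {T : ℝ} (hT : 0 < T)
    (hU : ∀ ξ, HasDerivAt U (U ξ * ω ξ) ξ) (hω : ∀ ξ, HasDerivAt ω (1 - U ξ) ξ)
    (hper : Function.Periodic U T ∧ Function.Periodic ω T) {s t : ℝ}
    (hUst : U s = U t) (hωst : ω s = ω t) :
    Function.Periodic U (t - s) ∧ Function.Periodic ω (t - s) := by
  set v : ℝ × ℝ → ℝ × ℝ := fun p => (p.1 * p.2, 1 - p.1) with hv
  set γ : ℝ → ℝ × ℝ := fun x => (U x, ω x) with hγ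
  have hγd : ∀ x, HasDerivAt γ (v (γ x)) x := fun x => (hU x).prodMk (hω x)
  have hγc : Continuous γ := continuous_iff_continuousAt.2 fun x => (hγd x).continuousAt
  have hγp : Function.Periodic γ T := fun x => Prod.ext (hper.1 x) (hper.2 x)
  obtain ⟨R, hR⟩ := (hγp.compact_of_continuous hT.ne' hγc).isBounded.subset_closedBall 0
  have hvs : ContDiff ℝ 1 v := by fun_prop
  obtain ⟨K, hK⟩ := hvs.contDiffOn.exists_lipschitzOnWith one_ne_zero
    (convex_closedBall (0 : ℝ × ℝ) R) (isCompact_closedBall 0 R)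
  have hshift : (fun x => γ (x + (t - s))) = γ := by
    refine ODE_solution_unique_univ (v := fun _ => v) (s := fun _ => Metric.closedBall 0 R)
      (t₀ := s) (fun _ => hK) (fun x => ⟨(hγd _).comp_add_const x (t - s), hR ⟨_, rfl⟩⟩)
      (fun x => ⟨hγd x, hR ⟨_, rfl⟩⟩) ?_
    simp [hγ, hUst, hωst]
  exact ⟨fun x => congrArg Prod.fst (congrFun hshift x),
    fun x => congrArg Prod.snd (congrFun hshift x)⟩

/-- Along a periodic orbit of energy `E`, the component `ω` attains both `√(2E)` and
`-√(2E)`. -/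
lemma exists_omega_eq_sqrt {U ω : ℝ → ℝ} {T E : ℝ} (hT : 0 < T) (hE : 0 < E)
    (hpos : ∀ ξ, 0 < U ξ)
    (hU : ∀ ξ, HasDerivAt U (U ξ * ω ξ) ξ) (hω : ∀ ξ, HasDerivAt ω (1 - U ξ) ξ)
    (hper : Function.Periodic U T ∧ Function.Periodic ω T)
    (henergy : ∀ ξ, -Real.log (U ξ) + (U ξ - 1) + ω ξ ^ 2 / 2 = E) :
    (∃ a, ω a = √(2 * E)) ∧ ∃ b, ω b = -√(2 * E) := by
  have hr : 0 < √(2 * E) := Real.sqrt_pos.2 (by linarith)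
  have hr2 : √(2 * E) ^ 2 = 2 * E := Real.sq_sqrt (by linarith)
  have hc : Continuous ω := continuous_iff_continuousAt.2 fun x => (hω x).continuousAt
  have hcpt := hper.2.compact_of_continuous hT.ne' hc
  have hcrit : ∀ x, IsLocalExtr ω x → ω x = √(2 * E) ∨ ω x = -√(2 * E) := by
    intro x hx
    have h1 : U x = 1 := by linarith [hx.hasDerivAt_eq_zero (hω x)]
    have h2 := henergy x
    rw [h1, Real.log_one] at h2
    exact sq_eq_sq_iff_eq_or_eq_neg.1 (by linarith)
  have hUT : U T = U 0 := by simpa using hper.1 0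
  obtain ⟨_, ⟨a, rfl⟩, ha⟩ := hcpt.exists_isGreatest (Set.range_nonempty ω)
  obtain ⟨_, ⟨b, rfl⟩, hb⟩ := hcpt.exists_isLeast (Set.range_nonempty ω)
  constructor
  · refine ⟨a, (hcrit a (Or.inr (Filter.Eventually.of_forall fun x => ha ⟨x, rfl⟩))).resolve_right
      fun h => ?_⟩
    have : StrictAnti U := strictAnti_of_deriv_neg fun x => by
      rw [(hU x).deriv]
      exact mul_neg_of_pos_of_neg (hpos x) (by linarith [ha ⟨x, rfl⟩])
    exact (this hT).ne hUT
  · refine ⟨b, (hcrit b (Or.inl (Filter.Eventually.of_forall fun x => hb ⟨x, rfl⟩))).resolve_left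
      fun h => ?_⟩
    have : StrictMono U := strictMono_of_deriv_pos fun x => by
      rw [(hU x).deriv]
      exact mul_pos (hpos x) (by linarith [hb ⟨x, rfl⟩])
    exact (this hT).ne' hUT

/-- Every `w ∈ (-√(2E), √(2E))` is attained by `ω` both while `U > 1` and while `U < 1`. -/
lemma exists_omega_eq_of_abs_lt {U ω : ℝ → ℝ} {T E w : ℝ} (hT : 0 < T) (hE : 0 < E)
    (hpos : ∀ ξ, 0 < U ξ)
    (hU : ∀ ξ, HasDerivAt U (U ξ * ω ξ) ξ) (hω : ∀ ξ, HasDerivAt ω (1 - U ξ) ξ)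
    (hper : Function.Periodic U T ∧ Function.Periodic ω T)
    (henergy : ∀ ξ, -Real.log (U ξ) + (U ξ - 1) + ω ξ ^ 2 / 2 = E)
    (hw : w ∈ Set.Ioo (-√(2 * E)) (√(2 * E))) :
    (∃ x, ω x = w ∧ 1 < U x) ∧ ∃ x, ω x = w ∧ U x < 1 := by
  have hr2 : √(2 * E) ^ 2 = 2 * E := Real.sq_sqrt (by linarith)
  have hne : ∀ x, ω x = w → U x ≠ 1 := by
    intro x hx h1
    have h2 := henergy x
    rw [h1, Real.log_one, hx] at h2
    nlinarith [hw.1, hw.2]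
  obtain ⟨⟨a, ha⟩, ⟨b, hb⟩⟩ := exists_omega_eq_sqrt hT hE hpos hU hω hper henergy
  have hc : Continuous ω := continuous_iff_continuousAt.2 fun x => (hω x).continuousAt
  have later : ∀ x y : ℝ, ∃ z, x ≤ z ∧ ω z = ω y := fun x y => by
    obtain ⟨z, hz, h⟩ := hper.2.exists_mem_Ico hT y x
    exact ⟨z, hz.1, h.symm⟩
  constructor
  · by_contra! hcon
    obtain ⟨z, hz, hzb⟩ := later a b
    have := image_le_of_deriv_right_lt_deriv_boundary (f := fun _ => w) (f' := fun _ => 0)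
      (a := a) (b := z) (B := ω) continuousOn_const (fun x _ => hasDerivWithinAt_const _ _ _)
      (by linarith [hw.2]) hω
      (fun x _ hx => by linarith [lt_of_le_of_ne (hcon x hx.symm) (hne x hx.symm)])
      (Set.right_mem_Icc.2 hz)
    linarith [hw.1]
  · by_contra! hcon
    obtain ⟨z, hz, hza⟩ := later b a
    have := image_le_of_deriv_right_lt_deriv_boundary (B := fun _ => w) (B' := fun _ => 0)
      (a := b) (b := z) (f := ω) hc.continuousOn (fun x _ => (hω x).hasDerivWithinAt)
      (by linarith [hw.1]) (fun x => hasDerivAt_const _ _)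
      (fun x _ hx => by linarith [lt_of_le_of_ne (hcon x hx) (hne x hx).symm])
      (Set.right_mem_Icc.2 hz)
    linarith [hw.2]

/-- Change of variables `w = ω ξ` along a piece of the orbit that is a graph over `ω`. -/
lemma integral_graph_eq {U ω g : ℝ → ℝ} {S D : Set ℝ} (hS : MeasurableSet S)
    (hω : ∀ ξ, HasDerivAt ω (1 - U ξ) ξ) (hinj : Set.InjOn ω S) (himg : ω '' S = D)
    (hg : ∀ ξ ∈ S, g (ω ξ) = U ξ) (hint : IntegrableOn (fun ξ => |1 - U ξ| * U ξ) S) :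
    IntegrableOn g D ∧ ∫ w in D, g w = ∫ ξ in S, |1 - U ξ| * U ξ := by
  have hd : ∀ ξ ∈ S, HasDerivWithinAt ω (1 - U ξ) S ξ := fun ξ _ => (hω ξ).hasDerivWithinAt
  have heq : Set.EqOn (fun ξ => |1 - U ξ| • g (ω ξ)) (fun ξ => |1 - U ξ| * U ξ) S :=
    fun ξ hξ => by simp [hg ξ hξ]
  subst himg
  refine ⟨(integrableOn_image_iff_integrableOn_abs_deriv_smul hS hd hinj g).2
    (hint.congr_fun heq.symm hS), ?_⟩
  rw [integral_image_eq_integral_abs_deriv_smul hS hd hinj g]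
  exact setIntegral_congr_fun hS heq

lemma setIntegral_Ioo_neg_comp_abs (f : ℝ → ℝ) (r : ℝ) :
    ∫ w in Set.Ioo (-r) r, f |w| = 2 * ∫ w in Set.Ioo 0 r, f w := by
  have h := integral_comp_abs (f := (Set.Iio r).indicator f)
  rw [setIntegral_indicator measurableSet_Iio, Set.Ioi_inter_Iio] at h
  rw [← h, ← integral_indicator measurableSet_Ioo]
  congr 1 with w
  simp only [Set.indicator, Set.mem_Ioo, Set.mem_Iio, abs_lt]

/-- The part of an orbit of minimal period `T` on which `ω` determines `U` is traversed
injectively during one period. -/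
lemma injOn_omega_of_minimal {U ω : ℝ → ℝ} {T : ℝ} {P : Set ℝ} (hT : 0 < T)
    (hU : ∀ ξ, HasDerivAt U (U ξ * ω ξ) ξ) (hω : ∀ ξ, HasDerivAt ω (1 - U ξ) ξ)
    (hper : Function.Periodic U T ∧ Function.Periodic ω T)
    (hmin : ∀ T' : ℝ, 0 < T' → T' < T →
      ¬ (Function.Periodic U T' ∧ Function.Periodic ω T'))
    (hP : ∀ x y, U x ∈ P → U y ∈ P → ω x = ω y → U x = U y) :
    Set.InjOn ω (Set.Ico 0 T ∩ U ⁻¹' P) := by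
  rintro x ⟨hx, hxP⟩ y ⟨hy, hyP⟩ hxy
  have hUxy := hP x y hxP hyP hxy
  rcases lt_trichotomy x y with h | h | h
  · exact absurd (periodic_sub_of_orbit_eq hT hU hω hper hUxy hxy)
      (hmin _ (by linarith) (by linarith [hx.1, hy.2]))
  · exact h
  · exact absurd (periodic_sub_of_orbit_eq hT hU hω hper hUxy.symm hxy.symm)
      (hmin _ (by linarith) (by linarith [hy.1, hx.2]))

/-- Over one period of the orbit, the energy gain equals `∫ U (U - 1)`. -/
lemma integral_energy_gain_eq {U ω : ℝ → ℝ} {T : ℝ} (hT : 0 < T)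
    (hU : ∀ ξ, HasDerivAt U (U ξ * ω ξ) ξ) (hω : ∀ ξ, HasDerivAt ω (1 - U ξ) ξ)
    (hper : Function.Periodic ω T) :
    ∫ ξ in Set.Ico (0 : ℝ) T, ((U ξ - 1) ^ 2 + ω ξ ^ 2 * (1 - U ξ)) =
      ∫ ξ in Set.Ico (0 : ℝ) T, U ξ * (U ξ - 1) := by
  have hUc : Continuous U := continuous_iff_continuousAt.2 fun x => (hU x).continuousAt
  have hωc : Continuous ω := continuous_iff_continuousAt.2 fun x => (hω x).continuousAt
  have hd : ∀ x ∈ Set.uIcc 0 T, HasDerivAt (fun x => ω x + ω x ^ 3 / 3)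
      ((1 + ω x ^ 2) * (1 - U x)) x := fun x _ => by
    refine ((hω x).fun_add (((hω x).fun_pow 3).div_const 3)).congr_deriv ?_
    push_cast
    ring
  have hzero := intervalIntegral.integral_eq_sub_of_hasDerivAt hd
    (Continuous.intervalIntegrable (by fun_prop) _ _)
  have hωT : ω T = ω 0 := by simpa using hper 0
  rw [hωT, sub_self] at hzero
  simp only [integral_Ico_eq_integral_Ioc, ← intervalIntegral.integral_of_le hT.le]
  rw [← sub_eq_zero, ← intervalIntegral.integral_sub
    (Continuous.intervalIntegrable (by fun_prop) _ _)
    (Continuous.intervalIntegrable (by fun_prop) _ _), ← hzero]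
  congr 1 with x
  ring

/-- For a nonconstant periodic solution `(U₀, ω₀)` of `U₀' = U₀ω₀`, `ω₀' = 1 - U₀`
with minimal period `T > 0` and energy `E > 0`, the integral of
`(U₀-1)² + ω₀²(1-U₀)` over one period equals
`Φ(E) = 2 ∫_0^{√(2E)} (U₊(E,ω) - U₋(E,ω)) dω`, where `U₋(E,ω) ∈ (0,1]` and
`U₊(E,ω) ∈ [1,∞)` are the two solutions of `log U - (U-1) = ω²/2 - E`. -/
theorem cycle_energy_gain (Um Up : ℝ → ℝ → ℝ)
    (hUm : ∀ E ω : ℝ, 0 < E → ω ∈ Set.Icc 0 (Real.sqrt (2*E)) →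
      Um E ω ∈ Set.Ioc (0:ℝ) 1 ∧ Real.log (Um E ω) - (Um E ω - 1) = ω ^ 2 / 2 - E)
    (hUp : ∀ E ω : ℝ, 0 < E → ω ∈ Set.Icc 0 (Real.sqrt (2*E)) →
      Up E ω ∈ Set.Ici (1:ℝ) ∧ Real.log (Up E ω) - (Up E ω - 1) = ω ^ 2 / 2 - E)
    (U ω : ℝ → ℝ) (T E : ℝ) (hT : 0 < T) (hE : 0 < E)
    (hpos : ∀ ξ, 0 < U ξ)
    (hU : ∀ ξ, HasDerivAt U (U ξ * ω ξ) ξ)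
    (hω : ∀ ξ, HasDerivAt ω (1 - U ξ) ξ)
    (hper : Function.Periodic U T ∧ Function.Periodic ω T)
    (hmin : ∀ T' : ℝ, 0 < T' → T' < T →
      ¬ (Function.Periodic U T' ∧ Function.Periodic ω T'))
    (hnonconst : ∃ ξ₁ ξ₂, U ξ₁ ≠ U ξ₂ ∨ ω ξ₁ ≠ ω ξ₂)
    (henergy : ∀ ξ, -Real.log (U ξ) + (U ξ - 1) + ω ξ ^ 2 / 2 = E) :
    ∫ ξ in Set.Ioo (0:ℝ) T, ((U ξ - 1) ^ 2 + ω ξ ^ 2 * (1 - U ξ)) =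
      2 * ∫ w in Set.Ioo (0:ℝ) (Real.sqrt (2*E)), (Up E w - Um E w) := by
  set r := √(2 * E) with hrdef
  have hr2 : r ^ 2 = 2 * E := Real.sq_sqrt (by linarith)
  have hr : 0 < r := Real.sqrt_pos.2 (by linarith)
  have hUc : Continuous U := continuous_iff_continuousAt.2 fun x => (hU x).continuousAt
  have hlog : ∀ x y, ω x = ω y → Real.log (U x) - U x = Real.log (U y) - U y := by
    intro x y hxy
    have h1 := henergy x
    have h2 := henergy y
    rw [hxy] at h1
    linarith
  have hωlt : ∀ x, U x ≠ 1 → ω x ∈ Set.Ioo (-r) r := fun x hx =>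
    abs_lt.1 (abs_lt_of_sq_lt_sq
      (by linarith [henergy x, Real.log_lt_sub_one_of_pos (hpos x) hx]) hr.le)
  have habs : ∀ x, U x ≠ 1 → |ω x| ∈ Set.Icc 0 r := fun x hx =>
    ⟨abs_nonneg _, (abs_lt.2 (hωlt x hx)).le⟩
  have himg : ∀ P : Set ℝ, (1 : ℝ) ∉ P →
      (∀ w ∈ Set.Ioo (-r) r, ∃ x, ω x = w ∧ U x ∈ P) →
      ω '' (Set.Ico 0 T ∩ U ⁻¹' P) = Set.Ioo (-r) r := by
    refine fun P hP hsurj => Set.Subset.antisymm ?_ fun w hw => ?_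
    · rintro _ ⟨x, ⟨-, hx⟩, rfl⟩
      exact hωlt x fun h => hP (h ▸ hx)
    · obtain ⟨x, rfl, hx⟩ := hsurj w hw
      have hpair : Function.Periodic (fun z => (U z, ω z)) T :=
        fun z => Prod.ext (hper.1 z) (hper.2 z)
      obtain ⟨y, hy, hxy⟩ := hpair.exists_mem_Ico₀ hT x
      rw [Prod.mk.injEq] at hxy
      exact ⟨y, ⟨hy, by rw [Set.mem_preimage, ← hxy.1]; exact hx⟩, hxy.2.symm⟩
  have hint : IntegrableOn (fun ξ => |1 - U ξ| * U ξ) (Set.Ico 0 T) :=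
    (Continuous.integrableOn_Icc (by fun_prop)).mono_set Set.Ico_subset_Icc_self
  have hmeas : ∀ P : Set ℝ, MeasurableSet P → MeasurableSet (U ⁻¹' P) :=
    fun P hP => hUc.measurable hP
  have hlarge := integral_graph_eq (g := fun w => Up E |w|)
    (measurableSet_Ico.inter (hmeas _ measurableSet_Ioi)) hω
    (injOn_omega_of_minimal (P := Set.Ioi 1) hT hU hω hper hmin fun x y hx hy hxy =>
      log_sub_self_injOn_Ici hx.le hy.le (hlog x y hxy))
    (himg (Set.Ioi 1) Set.self_notMem_Ioi fun w hw =>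
      (exists_omega_eq_of_abs_lt hT hE hpos hU hω hper henergy hw).1)
    (fun x hx => by
      obtain ⟨h1, h2⟩ := hUp E |ω x| hE (habs x hx.2.ne')
      refine log_sub_self_injOn_Ici h1 hx.2.le ?_
      rw [sq_abs] at h2
      linarith [henergy x])
    (hint.mono_set Set.inter_subset_left)
  have hsmall := integral_graph_eq (g := fun w => Um E |w|)
    (measurableSet_Ico.inter (hmeas _ measurableSet_Iio)) hω
    (injOn_omega_of_minimal (P := Set.Iio 1) hT hU hω hper hmin fun x y hx hy hxy =>
      log_sub_self_injOn_Ioc (hpos x) (hpos y) hx.le hy.le (hlog x y hxy))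
    (himg (Set.Iio 1) Set.self_notMem_Iio fun w hw =>
      (exists_omega_eq_of_abs_lt hT hE hpos hU hω hper henergy hw).2)
    (fun x hx => by
      obtain ⟨h1, h2⟩ := hUm E |ω x| hE (habs x hx.2.ne)
      refine log_sub_self_injOn_Ioc h1.1 (hpos x) h1.2 hx.2.le ?_
      rw [sq_abs] at h2
      linarith [henergy x])
    (hint.mono_set Set.inter_subset_left)
  rw [← integral_Ico_eq_integral_Ioo, integral_energy_gain_eq hT hU hω hper.2,
    ← setIntegral_Ioo_neg_comp_abs (fun w => Up E w - Um E w) r,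
    integral_sub hlarge.1 hsmall.1, hlarge.2, hsmall.2,
    ← setIntegral_indicator (hmeas _ measurableSet_Ioi),
    ← setIntegral_indicator (hmeas _ measurableSet_Iio),
    ← integral_sub (hint.indicator (hmeas _ measurableSet_Ioi))
      (hint.indicator (hmeas _ measurableSet_Iio))]
  congr 1 with x
  simp only [Set.indicator, Set.mem_preimage, Set.mem_Ioi, Set.mem_Iio]
  rcases lt_trichotomy (U x) 1 with h | h | h
  · rw [if_neg h.not_gt, if_pos h, abs_of_pos (by linarith)]
    ring
  · simp [h]
  · rw [if_pos h, if_neg h.not_gt, abs_of_neg (by linarith)]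
    ring
end

section
/- With $\Phi(E):=2\int_0^{\sqrt{2E}}\big(U_+(E,\omega)-U_-(E,\omega)\big)\,d\omega$, one has the asymptotics $\lim_{E\to\infty}\frac{\Phi(E)}{E^{3/2}}=\frac{4\sqrt{2}}{3}$. -/
open MeasureTheory Filter

/-- Strict concavity of the logarithm, applied to `U ↦ log U - (U - 1)`. -/
lemma log_sub_lt_log_sub {x y : ℝ} (hx : 0 < x) (hy : 0 < y) (hne : y ≠ x)
    (h : (y - x) * (1 - x) ≤ 0) :
    Real.log y - (y - 1) < Real.log x - (x - 1) := by
  have h1 : Real.log (y / x) < y / x - 1 := by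
    refine Real.log_lt_sub_one_of_pos (div_pos hy hx) fun h0 => hne ?_
    rwa [div_eq_one_iff_eq hx.ne'] at h0
  rw [Real.log_div hy.ne' hx.ne'] at h1
  have h2 : y / x - 1 - (y - x) = (y - x) * (1 - x) / x := by
    field_simp
  have h3 : (y - x) * (1 - x) / x ≤ 0 := div_nonpos_of_nonpos_of_nonneg h hx.le
  linarith

lemma log_le_log_of_log_sub_eq {U a E : ℝ} (hU : 1 ≤ U) (ha : a ≤ E) (hE : 1 ≤ E)
    (h : Real.log U - (U - 1) = -a) : Real.log U ≤ Real.log 4 + Real.log E := by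
  have hU0 : 0 < U := by linarith
  have h1 : Real.log (U / 2) ≤ U / 2 - 1 := Real.log_le_sub_one_of_pos (by positivity)
  rw [Real.log_div hU0.ne' two_ne_zero] at h1
  have h2 : Real.log 2 ≤ 2 - 1 := Real.log_le_sub_one_of_pos two_pos
  rw [← Real.log_mul (by norm_num) (by linarith)]
  exact Real.log_le_log hU0 (by linarith)

lemma setIntegral_Ioo_sub_sq {E : ℝ} (c : ℝ) (hE : 0 < E) :
    ∫ ω in Set.Ioo (0 : ℝ) (Real.sqrt (2 * E)), (E - ω ^ 2 / 2 + c)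
      = Real.sqrt (2 * E) * (2 / 3 * E + c) := by
  rw [← integral_Ioc_eq_integral_Ioo, ← intervalIntegral.integral_of_le (Real.sqrt_nonneg _)]
  have hs : Real.sqrt (2 * E) ^ 2 = 2 * E := Real.sq_sqrt (by positivity)
  have key : ∀ ω ∈ Set.uIcc (0 : ℝ) (Real.sqrt (2 * E)),
      HasDerivAt (fun ω : ℝ => E * ω - ω ^ 3 / 6 + c * ω) (E - ω ^ 2 / 2 + c) ω := by
    intro ω _
    have := (((hasDerivAt_id ω).const_mul E).sub ((hasDerivAt_pow 3 ω).div_const 6)).add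
      ((hasDerivAt_id ω).const_mul c)
    exact this.congr_deriv (by push_cast; ring)
  rw [intervalIntegral.integral_eq_sub_of_hasDerivAt key
    (Continuous.intervalIntegrable (by fun_prop) _ _)]
  linear_combination (-Real.sqrt (2 * E) / 6) * hs

/-- With `Φ(E) = 2 ∫_0^{√(2E)} (U₊(E,ω) - U₋(E,ω)) dω`, where `U₋(E,ω) ∈ (0,1]` and
`U₊(E,ω) ∈ [1,∞)` are the two solutions of `log U - (U-1) = ω²/2 - E`, one has
`lim_{E→∞} Φ(E)/E^{3/2} = 4√2/3`. -/
theorem Phi_asymptotics (Um Up : ℝ → ℝ → ℝ)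
    (hUm : ∀ E ω : ℝ, 0 < E → ω ∈ Set.Icc 0 (Real.sqrt (2*E)) →
      Um E ω ∈ Set.Ioc (0:ℝ) 1 ∧ Real.log (Um E ω) - (Um E ω - 1) = ω ^ 2 / 2 - E)
    (hUp : ∀ E ω : ℝ, 0 < E → ω ∈ Set.Icc 0 (Real.sqrt (2*E)) →
      Up E ω ∈ Set.Ici (1:ℝ) ∧ Real.log (Up E ω) - (Up E ω - 1) = ω ^ 2 / 2 - E) :
    Tendsto (fun E : ℝ =>
        (2 * ∫ ω in Set.Ioo (0:ℝ) (Real.sqrt (2*E)), (Up E ω - Um E ω)) / E ^ ((3:ℝ)/2))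
      atTop (nhds (4 * Real.sqrt 2 / 3)) := by
  have hanti : ∀ E : ℝ, 0 < E → AntitoneOn (Up E) (Set.Icc 0 (Real.sqrt (2 * E))) := by
    intro E hE x hx y hy hxy
    obtain ⟨h1, h2⟩ := hUp E x hE hx
    obtain ⟨h3, h4⟩ := hUp E y hE hy
    rw [Set.mem_Ici] at h1 h3
    by_contra! hlt
    have := log_sub_lt_log_sub (by linarith) (by linarith) hlt.ne'
      (mul_nonpos_of_nonneg_of_nonpos (by linarith) (by linarith))
    have := pow_le_pow_left₀ hx.1 hxy 2
    linarith
  have hmono : ∀ E : ℝ, 0 < E → MonotoneOn (Um E) (Set.Icc 0 (Real.sqrt (2 * E))) := by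
    intro E hE x hx y hy hxy
    obtain ⟨h1, h2⟩ := hUm E x hE hx
    obtain ⟨h3, h4⟩ := hUm E y hE hy
    by_contra! hlt
    have := log_sub_lt_log_sub h1.1 h3.1 hlt.ne
      (mul_nonpos_of_nonpos_of_nonneg (by linarith) (by linarith [h1.2]))
    have := pow_le_pow_left₀ hx.1 hxy 2
    linarith
  have hint : ∀ E : ℝ, 0 < E → IntegrableOn (fun ω => Up E ω - Um E ω)
      (Set.Ioo 0 (Real.sqrt (2 * E))) := fun E hE =>
    (((hanti E hE).integrableOn_isCompact isCompact_Icc).sub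
      ((hmono E hE).integrableOn_isCompact isCompact_Icc)).mono_set Set.Ioo_subset_Icc_self
  have hpoly : ∀ E c : ℝ, IntegrableOn (fun ω : ℝ => E - ω ^ 2 / 2 + c)
      (Set.Ioo 0 (Real.sqrt (2 * E))) := fun E c =>
    ((by fun_prop : Continuous fun ω : ℝ => E - ω ^ 2 / 2 + c).continuousOn.integrableOn_compact
      isCompact_Icc).mono_set Set.Ioo_subset_Icc_self
  have hscale : ∀ E c : ℝ, 0 < E →
      2 * (Real.sqrt (2 * E) * (2 / 3 * E + c)) / E ^ ((3 : ℝ) / 2)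
        = 4 * Real.sqrt 2 / 3 + 2 * Real.sqrt 2 * (c / E) := by
    intro E c hE
    have hp : E ^ ((3 : ℝ) / 2) = E * Real.sqrt E := by
      rw [Real.sqrt_eq_rpow, show (3 : ℝ) / 2 = 1 + 1 / 2 by norm_num, Real.rpow_add hE,
        Real.rpow_one]
    have hs : 0 < Real.sqrt E := Real.sqrt_pos.2 hE
    rw [hp, Real.sqrt_mul two_pos.le]
    field_simp
    ring
  have hlog : Tendsto (fun E : ℝ => (1 + (Real.log 4 + Real.log E)) / E) atTop (nhds 0) := by
    have h1 : Tendsto (fun E : ℝ => (1 + Real.log 4) / E) atTop (nhds 0) :=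
      tendsto_const_nhds.div_atTop tendsto_id
    have h2 : Tendsto (fun E : ℝ => Real.log E / E) atTop (nhds 0) :=
      Real.isLittleO_log_id_atTop.tendsto_div_nhds_zero
    have h3 := h1.add h2
    rw [add_zero] at h3
    exact h3.congr fun E => by ring
  have hupper : Tendsto (fun E : ℝ => 4 * Real.sqrt 2 / 3
      + 2 * Real.sqrt 2 * ((1 + (Real.log 4 + Real.log E)) / E)) atTop
      (nhds (4 * Real.sqrt 2 / 3)) := by
    simpa using (hlog.const_mul (2 * Real.sqrt 2)).const_add (4 * Real.sqrt 2 / 3)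
  refine tendsto_of_tendsto_of_tendsto_of_le_of_le' tendsto_const_nhds hupper ?_ ?_
  · filter_upwards [eventually_ge_atTop 1] with E hE
    have hE0 : 0 < E := by linarith
    have h := setIntegral_mono_on (hpoly E 0) (hint E hE0) measurableSet_Ioo fun ω hω => by
      obtain ⟨h1, h2⟩ := hUp E ω hE0 (Set.Ioo_subset_Icc_self hω)
      obtain ⟨h3, -⟩ := hUm E ω hE0 (Set.Ioo_subset_Icc_self hω)
      linarith [Real.log_nonneg h1, h3.2]
    rw [setIntegral_Ioo_sub_sq 0 hE0] at h
    have hs := hscale E 0 hE0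
    rw [zero_div, mul_zero, add_zero (4 * Real.sqrt 2 / 3)] at hs
    rw [← hs]
    gcongr
  · filter_upwards [eventually_ge_atTop 1] with E hE
    have hE0 : 0 < E := by linarith
    have h := setIntegral_mono_on (hint E hE0) (hpoly E (1 + (Real.log 4 + Real.log E)))
      measurableSet_Ioo fun ω hω => by
        obtain ⟨h1, h2⟩ := hUp E ω hE0 (Set.Ioo_subset_Icc_self hω)
        obtain ⟨h3, -⟩ := hUm E ω hE0 (Set.Ioo_subset_Icc_self hω)
        have := log_le_log_of_log_sub_eq (a := E - ω ^ 2 / 2) h1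
          (by linarith [sq_nonneg ω]) hE (by linarith)
        linarith [h3.1]
    rw [setIntegral_Ioo_sub_sq _ hE0] at h
    rw [← hscale E _ hE0]
    gcongr
end

section
/- Let $\kappa>0$ and define on $(0,\infty)$ the functions $\bar v(x)=2e^{-\kappa x}$, $\bar h(x)=2\kappa x\,e^{-\kappa x}$ and $\bar u(x)=\frac{2}{\kappa x}\big(1-(1+\kappa x)e^{-\kappa x}\big)$. Then for every $x>0$: (i) $\bar h(x)=\bar u(x)\bar v(x)+\frac{1}{x}\int_0^x \bar h(y)\Big(\int_{x-y}^{x}\frac{\bar h(z)}{z}\,dz\Big)dy$; (ii) $x\,\bar u'(x)=-\bar u(x)+\bar h(x)$; (iii) $x\,\bar v'(x)=-\bar h(x)$. -/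
open MeasureTheory

/-- The derivative of `t ↦ e^{-κt}`. -/
theorem hasDerivAt_exp_neg_const_mul (κ x : ℝ) :
    HasDerivAt (fun t => Real.exp (-(κ*t))) (-κ * Real.exp (-(κ*x))) x := by
  refine ((hasDerivAt_id' x).const_mul κ).fun_neg.exp.congr_deriv ?_
  ring

/-- The derivative of `t ↦ (1+κt)e^{-κt}`. -/
theorem hasDerivAt_one_add_mul_exp_neg (κ x : ℝ) :
    HasDerivAt (fun t => (1+κ*t)*Real.exp (-(κ*t))) (-(κ^2*x*Real.exp (-(κ*x)))) x := by
  refine ((((hasDerivAt_id' x).const_mul κ).const_add 1).mul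
    (hasDerivAt_exp_neg_const_mul κ x)).congr_deriv ?_
  ring

/-- The integral of `2κ e^{-κz}`, written as `h̄(z)/z`, over an interval of positive reals. -/
theorem integral_two_mul_mul_exp_neg_div (κ : ℝ) {a b : ℝ} (ha : 0 < a) (hab : a ≤ b) :
    ∫ z in a..b, (2*κ*z*Real.exp (-(κ*z)))/z =
      2*(Real.exp (-(κ*a)) - Real.exp (-(κ*b))) := by
  have hcongr : ∫ z in a..b, (2*κ*z*Real.exp (-(κ*z)))/z =
      ∫ z in a..b, -2 * (-κ * Real.exp (-(κ*z))) := by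
    refine intervalIntegral.integral_congr fun z hz => ?_
    rw [Set.uIcc_of_le hab] at hz
    have hz0 : z ≠ 0 := (ha.trans_le hz.1).ne'
    field_simp
  rw [hcongr, intervalIntegral.integral_eq_sub_of_hasDerivAt
    (fun z _ => (hasDerivAt_exp_neg_const_mul κ z).const_mul (-2))
    (Continuous.intervalIntegrable (by fun_prop) _ _)]
  ring

/-- The value of `∫_0^x h̄(y) ∫_{x-y}^x h̄(z)/z dz dy`. -/
theorem integral_mul_integral_exp_neg {κ x : ℝ} (hκ : κ ≠ 0) (hx : 0 ≤ x) :
    ∫ y in Set.Ioo (0:ℝ) x,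
        (2*κ*y*Real.exp (-(κ*y))) * ∫ z in (x-y)..x, (2*κ*z*Real.exp (-(κ*z)))/z =
      4*κ*Real.exp (-(κ*x)) *
        (x^2/2 - (1-(1+κ*x)*Real.exp (-(κ*x)))/κ^2) := by
  have hcongr : ∫ y in Set.Ioo (0:ℝ) x,
        (2*κ*y*Real.exp (-(κ*y))) * ∫ z in (x-y)..x, (2*κ*z*Real.exp (-(κ*z)))/z =
      ∫ y in Set.Ioo (0:ℝ) x, 4*κ*Real.exp (-(κ*x)) * (y - y*Real.exp (-(κ*y))) := by
    refine setIntegral_congr_fun measurableSet_Ioo fun y hy => ?_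
    have hexp : Real.exp (-(κ*y)) * Real.exp (-(κ*(x-y))) = Real.exp (-(κ*x)) := by
      rw [← Real.exp_add]
      ring_nf
    rw [integral_two_mul_mul_exp_neg_div κ (sub_pos.2 hy.2) (sub_le_self x hy.1.le)]
    linear_combination 4*κ*y*hexp
  have hderiv (y : ℝ) : HasDerivAt
      (fun t => 4*κ*Real.exp (-(κ*x)) * (t^2/2 + (1+κ*t)*Real.exp (-(κ*t))/κ^2))
      (4*κ*Real.exp (-(κ*x)) * (y - y*Real.exp (-(κ*y)))) y := by
    refine ((((hasDerivAt_pow 2 y).div_const 2).add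
      ((hasDerivAt_one_add_mul_exp_neg κ y).div_const (κ^2))).const_mul
        (4*κ*Real.exp (-(κ*x)))).congr_deriv ?_
    push_cast
    field_simp
    ring
  rw [hcongr, ← integral_Ioc_eq_integral_Ioo, ← intervalIntegral.integral_of_le hx,
    intervalIntegral.integral_eq_sub_of_hasDerivAt (fun y _ => hderiv y)
      (Continuous.intervalIntegrable (by fun_prop) _ _)]
  simp only [mul_zero, neg_zero, Real.exp_zero]
  ring

/-- For `κ > 0`, the functions `v̄(x) = 2e^{-κx}`, `h̄(x) = 2κx e^{-κx}` and
`ū(x) = (2/(κx))(1-(1+κx)e^{-κx})` satisfy, for every `x > 0`: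
(i) `h̄ = ū v̄ + (1/x)∫_0^x h̄(y) ∫_{x-y}^x h̄(z)/z dz dy`;
(ii) `x ū' = -ū + h̄`; (iii) `x v̄' = -h̄`. -/
theorem explicit_solution_a_one (κ : ℝ) (hκ : 0 < κ) (x : ℝ) (hx : 0 < x) :
    (2*κ*x*Real.exp (-(κ*x)) =
      ((2/(κ*x))*(1-(1+κ*x)*Real.exp (-(κ*x)))) * (2*Real.exp (-(κ*x))) +
      (1/x) * ∫ y in Set.Ioo (0:ℝ) x,
        (2*κ*y*Real.exp (-(κ*y))) * ∫ z in (x-y)..x, (2*κ*z*Real.exp (-(κ*z)))/z) ∧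
    (∃ d : ℝ, HasDerivAt (fun t => (2/(κ*t))*(1-(1+κ*t)*Real.exp (-(κ*t)))) d x ∧
      x * d = -((2/(κ*x))*(1-(1+κ*x)*Real.exp (-(κ*x)))) + 2*κ*x*Real.exp (-(κ*x))) ∧
    (∃ d : ℝ, HasDerivAt (fun t => 2*Real.exp (-(κ*t))) d x ∧
      x * d = -(2*κ*x*Real.exp (-(κ*x)))) := by
  have hκ0 : κ ≠ 0 := hκ.ne'
  have hx0 : x ≠ 0 := hx.ne'
  refine ⟨?_, ⟨_, ((hasDerivAt_const x (2:ℝ)).fun_div ((hasDerivAt_id' x).const_mul κ) (mul_ne_zero hκ0 hx0)).mul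
    ((hasDerivAt_one_add_mul_exp_neg κ x).const_sub 1), ?_⟩,
    ⟨_, (hasDerivAt_exp_neg_const_mul κ x).const_mul 2, by ring⟩⟩
  · rw [integral_mul_integral_exp_neg hκ0 hx.le]
    field_simp
    ring
  · field_simp
    ring
end

section
/- Let $\bar v:(0,\infty)\to\mathbb{R}$ be continuously differentiable and bounded, suppose $\bar h(y):=-y\,\bar v'(y)$ is integrable on $(0,x)$ for every $x>0$, set $\bar u(x):=\frac{1}{x}\int_0^x\bar h(y)\,dy$, and assume that for every $x>0$ the equation $\bar h(x)=\bar u(x)\bar v(x)+\frac{1}{x}\int_0^x \bar h(y)\Big(\int_{x-y}^{x}\frac{\bar h(z)}{z}\,dz\Big)dy$ holds. Then $\bar v$ satisfies the convolution equation $x^2\,\bar v'(x)=\int_0^x y\,\bar v'(y)\,\bar v(x-y)\,dy$ for every $x>0$. -/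
open MeasureTheory

/-- Let `v̄` be continuously differentiable (with derivative `v'`) and bounded on
`(0,∞)`, let `h̄(y) = -y v'(y)` be integrable on `(0,x)` for every `x > 0`, set
`ū(x) = (1/x)∫_0^x h̄`, and assume the integral equation
`h̄ = ū v̄ + (1/x)∫_0^x h̄(y) ∫_{x-y}^x h̄(z)/z dz dy` holds for every `x > 0`.
Then `x² v'(x) = ∫_0^x y v'(y) v̄(x-y) dy` for every `x > 0`. -/
theorem convolution_equation (v v' : ℝ → ℝ)
    (hderiv : ∀ x : ℝ, 0 < x → HasDerivAt v (v' x) x)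
    (hcont : ContinuousOn v' (Set.Ioi 0))
    (hbdd : ∃ M : ℝ, ∀ x : ℝ, 0 < x → |v x| ≤ M)
    (hint : ∀ x : ℝ, 0 < x → IntegrableOn (fun y => -y * v' y) (Set.Ioo 0 x))
    (heq : ∀ x : ℝ, 0 < x →
      -x * v' x = ((1/x) * ∫ y in Set.Ioo (0:ℝ) x, -y * v' y) * v x +
        (1/x) * ∫ y in Set.Ioo (0:ℝ) x,
          (-y * v' y) * ∫ z in (x-y)..x, (-z * v' z) / z) :
    ∀ x : ℝ, 0 < x →
      x ^ 2 * v' x = ∫ y in Set.Ioo (0:ℝ) x, y * v' y * v (x - y) := by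
  obtain ⟨M, hM⟩ := hbdd
  intro x hx
  have hvcont : ContinuousOn v (Set.Ioi 0) := fun y hy =>
    (hderiv y hy).continuousAt.continuousWithinAt
  have inner_integral : ∀ y ∈ Set.Ioo (0:ℝ) x,
      (∫ z in (x-y)..x, (-z * v' z) / z) = v (x - y) - v x := by
    intro y hy
    have hpos : ∀ z ∈ Set.uIcc (x - y) x, 0 < z := by
      intro z hz
      rw [Set.uIcc_of_le (by linarith [hy.1])] at hz
      linarith [hz.1, hy.2]
    have hcongr : (∫ z in (x-y)..x, (-z * v' z) / z) = ∫ z in (x-y)..x, -v' z := by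
      refine intervalIntegral.integral_congr fun z hz => ?_
      have := (hpos z hz).ne'
      field_simp
    rw [hcongr, intervalIntegral.integral_neg,
      intervalIntegral.integral_eq_sub_of_hasDerivAt (fun z hz => hderiv z (hpos z hz))
        ((hcont.mono fun z hz => hpos z hz).intervalIntegrable)]
    ring
  have hprod : IntegrableOn (fun y => (-y * v' y) * v (x - y)) (Set.Ioo 0 x) := by
    refine Integrable.mul_bdd (c := M) (hint x hx) ?_ ?_
    · refine ContinuousOn.aestronglyMeasurable ?_ measurableSet_Ioo
      exact hvcont.comp (by fun_prop) fun y hy => sub_pos.2 hy.2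
    · refine (ae_restrict_iff' measurableSet_Ioo).2 (Filter.Eventually.of_forall fun y hy => ?_)
      exact hM _ (sub_pos.2 hy.2)
  have houter : (∫ y in Set.Ioo (0:ℝ) x, (-y * v' y) * ∫ z in (x-y)..x, (-z * v' z) / z) =
      (∫ y in Set.Ioo (0:ℝ) x, (-y * v' y) * v (x - y)) -
        (∫ y in Set.Ioo (0:ℝ) x, -y * v' y) * v x := by
    rw [← integral_mul_const, ← integral_sub hprod ((hint x hx).mul_const _)]
    refine setIntegral_congr_fun measurableSet_Ioo fun y hy => ?_
    simp only [inner_integral y hy]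
    ring
  have hneg : (∫ y in Set.Ioo (0:ℝ) x, (-y * v' y) * v (x - y)) =
      -∫ y in Set.Ioo (0:ℝ) x, y * v' y * v (x - y) := by
    rw [← integral_neg]
    simp only [neg_mul]
  have h := heq x hx
  rw [houter, hneg] at h
  field_simp at h
  linarith
end

section
/- Let $a\in(0,2)$ and $\kappa>0$, and define $w:(0,\infty)\to\mathbb{R}$ by $w(\zeta)=\frac{1}{\zeta}\Big[1+a\,\frac{\zeta^a-\kappa}{\zeta^a+\kappa}\Big]$. Then $w$ satisfies the ordinary differential equation $\frac{d^2}{d\zeta^2}\big(\zeta w(\zeta)\big)+w(\zeta)\,\frac{d}{d\zeta}\big(\zeta w(\zeta)\big)=0$ for all $\zeta>0$. -/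
/-- The power rule for `t ↦ t ^ a` at a positive point, with `t ^ (a - 1)` written `t ^ a / t`. -/
theorem hasDerivAt_rpow_div {a t : ℝ} (ht : 0 < t) :
    HasDerivAt (fun x : ℝ => x ^ a) (a * (t ^ a / t)) t := by
  have h := Real.hasDerivAt_rpow_const (x := t) (p := a) (Or.inl ht.ne')
  rwa [Real.rpow_sub_one ht.ne'] at h

/-- The first derivative of `t w(t)`. -/
theorem hasDerivAt_mul_laplace_transform {a κ t : ℝ} (hκ : 0 < κ) (ht : 0 < t) :
    HasDerivAt (fun t : ℝ => t * ((1/t) * (1 + a * ((t ^ a - κ)/(t ^ a + κ)))))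
      (2 * κ * a ^ 2 * t ^ a / (t * (t ^ a + κ) ^ 2)) t := by
  have hp : 0 < t ^ a := Real.rpow_pos_of_pos ht a
  have hpk : t ^ a + κ ≠ 0 := by positivity
  have hd := hasDerivAt_rpow_div (a := a) ht
  have h := (((hd.sub_const κ).div (hd.add_const κ) hpk).const_mul a).const_add 1
  refine (h.congr_of_eventuallyEq ?_).congr_deriv ?_
  · filter_upwards [eventually_gt_nhds ht] with x hx
    simp only [Pi.div_apply]
    field_simp
  · field_simp
    ring

/-- The derivative of the closed form of `(t w(t))'`. -/
theorem hasDerivAt_deriv_mul_laplace_transform {a κ t : ℝ} (hκ : 0 < κ) (ht : 0 < t) :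
    HasDerivAt (fun t : ℝ => 2 * κ * a ^ 2 * t ^ a / (t * (t ^ a + κ) ^ 2))
      (-((1/t) * (1 + a * ((t ^ a - κ)/(t ^ a + κ)))) *
        (2 * κ * a ^ 2 * t ^ a / (t * (t ^ a + κ) ^ 2))) t := by
  have hp : 0 < t ^ a := Real.rpow_pos_of_pos ht a
  have hpk : t * (t ^ a + κ) ^ 2 ≠ 0 := by positivity
  have hd := hasDerivAt_rpow_div (a := a) ht
  have h := (hd.const_mul (2 * κ * a ^ 2)).div
    ((hasDerivAt_id' t).mul ((hd.add_const κ).pow 2)) hpk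
  refine h.congr_deriv ?_
  simp only [Pi.mul_apply, Pi.pow_apply]
  field_simp
  ring

/-- For `a ∈ (0,2)` and `κ > 0`, the function
`w(ζ) = (1/ζ)[1 + a (ζ^a - κ)/(ζ^a + κ)]` satisfies
`(ζ w)'' + w (ζ w)' = 0` for all `ζ > 0`. -/
theorem laplace_transform_ode (a κ : ℝ) (ha : 0 < a) (ha' : a < 2) (hκ : 0 < κ) :
    ∀ ζ : ℝ, 0 < ζ →
      deriv (deriv (fun t : ℝ => t * ((1/t) * (1 + a * ((t ^ a - κ)/(t ^ a + κ)))))) ζ +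
        ((1/ζ) * (1 + a * ((ζ ^ a - κ)/(ζ ^ a + κ)))) *
          deriv (fun t : ℝ => t * ((1/t) * (1 + a * ((t ^ a - κ)/(t ^ a + κ))))) ζ = 0 := by
  intro ζ hζ
  have h : deriv (fun t : ℝ => t * ((1/t) * (1 + a * ((t ^ a - κ)/(t ^ a + κ))))) =ᶠ[nhds ζ]
      fun t : ℝ => 2 * κ * a ^ 2 * t ^ a / (t * (t ^ a + κ) ^ 2) := by
    filter_upwards [eventually_gt_nhds hζ] with x hx
    exact (hasDerivAt_mul_laplace_transform hκ hx).deriv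
  rw [h.deriv_eq, (hasDerivAt_deriv_mul_laplace_transform hκ hζ).deriv,
    (hasDerivAt_mul_laplace_transform hκ hζ).deriv]
  ring
end

section
/- Let $0<a<1$ and $\kappa>0$, and define $\bar v:(0,\infty)\to\mathbb{R}$ by $\bar v(x)=(1-a)+\frac{2a\kappa\sin(\pi a)}{\pi}\int_0^\infty \frac{e^{-rx}\,r^{a-1}}{r^{2a}+2\kappa\cos(\pi a)\,r^{a}+\kappa^2}\,dr$. Then for every $\zeta>0$ the Laplace transform of $\bar v$ satisfies $\int_0^\infty \bar v(x)\,e^{-\zeta x}\,dx=\frac{1}{\zeta}\Big[1+a\,\frac{\zeta^a-\kappa}{\zeta^a+\kappa}\Big]$. -/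
open MeasureTheory Real

section Contour

open Complex Filter Topology Set Interval

/-- `e^{aw}/(e^{aw}+κ)`, corrected by a multiple of `e^{w/2}` so that it vanishes at `w = 0`. -/
noncomputable def contourNum (a κ : ℝ) (w : ℂ) : ℂ :=
  cexp (a * w) / (cexp (a * w) + κ) - 1 / (1 + κ) * cexp (w / 2)

/-- The quotient `contourNum a κ w / (e^w - 1)` with its singularity at `0` removed. -/
noncomputable def contourQuot (a κ : ℝ) (w : ℂ) : ℂ :=
  dslope (contourNum a κ) 0 w / dslope cexp 0 w

lemma contourQuot_of_ne {a κ : ℝ} {w : ℂ} (hw : w ≠ 0) :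
    contourQuot a κ w = contourNum a κ w / (cexp w - 1) := by
  have h0 : contourNum a κ 0 = 0 := by
    simp [contourNum]
  rw [contourQuot, dslope_of_ne _ hw, dslope_of_ne _ hw, slope_def_field, slope_def_field, h0]
  simp only [sub_zero, Complex.exp_zero]
  rw [div_div_div_cancel_right₀ hw]

lemma exp_add_ofReal_ne_zero {κ : ℝ} (hκ : 0 < κ) {w : ℂ} (hw : |w.im| < π) :
    cexp w + κ ≠ 0 := by
  intro h
  have him := congrArg Complex.im h
  have hre := congrArg Complex.re h
  simp only [add_im, exp_im, ofReal_im, add_zero, zero_im, mul_eq_zero, (Real.exp_pos _).ne',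
    false_or] at him
  rw [Real.sin_eq_zero_iff_of_lt_of_lt (abs_lt.1 hw).1 (abs_lt.1 hw).2] at him
  simp only [add_re, exp_re, him, Real.cos_zero, mul_one, ofReal_re, zero_re] at hre
  linarith [Real.exp_pos w.re]

lemma dslope_exp_ne_zero {w : ℂ} (hw : |w.im| < 2 * π) : dslope cexp 0 w ≠ 0 := by
  rcases eq_or_ne w 0 with rfl | h
  · simp [dslope_same]
  · rw [dslope_of_ne _ h, slope_def_field]
    refine div_ne_zero (fun h1 => h ?_) (by simpa using h)
    rw [Complex.exp_zero, sub_eq_zero, Complex.exp_eq_one_iff] at h1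
    obtain ⟨n, rfl⟩ := h1
    have hn : |(n : ℝ)| < 1 := by
      have : |(n : ℝ)| * (2 * π) < 1 * (2 * π) := by
        simpa [abs_mul, abs_of_pos Real.pi_pos] using hw
      exact lt_of_mul_lt_mul_right this (by positivity)
    have : n = 0 := by
      rw [← Int.abs_lt_one_iff]; exact_mod_cast hn
    simp [this]

lemma differentiableOn_contourQuot {a κ : ℝ} (hκ : 0 < κ) :
    DifferentiableOn ℂ (contourQuot a κ) {w | |w.im| < 2 * π ∧ |a * w.im| < π} := by
  have hopen : IsOpen {w : ℂ | |w.im| < 2 * π ∧ |a * w.im| < π} :=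
    (isOpen_lt (continuous_abs.comp continuous_im) continuous_const).inter
      (isOpen_lt (continuous_abs.comp (continuous_im.const_mul a)) continuous_const)
  have h0 : {w : ℂ | |w.im| < 2 * π ∧ |a * w.im| < π} ∈ 𝓝 (0 : ℂ) :=
    hopen.mem_nhds (by simp [Real.pi_pos])
  refine DifferentiableOn.div ((differentiableOn_dslope h0).2 ?_) ((differentiableOn_dslope h0).2 ?_)
    fun w hw => dslope_exp_ne_zero hw.1
  · unfold contourNum
    refine DifferentiableOn.sub (DifferentiableOn.div (by fun_prop) (by fun_prop) fun w hw => ?_)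
      (by fun_prop)
    exact exp_add_ofReal_ne_zero hκ (by simpa using hw.2)
  · fun_prop

/-- A bound for `contourQuot a κ` on the vertical line with real part `x`. -/
noncomputable def contourBound (a κ x : ℝ) : ℝ :=
  (rexp (a * x) / |rexp (a * x) - κ| + 1 / (1 + κ) * rexp (x / 2)) / |rexp x - 1|

lemma norm_contourQuot_le {a κ x : ℝ} (hκ : 0 < κ) (hx : x ≠ 0) (hxκ : rexp (a * x) ≠ κ) (y : ℝ) :
    ‖contourQuot a κ (x + y * I)‖ ≤ contourBound a κ x := by
  have hw : (x + y * I : ℂ) ≠ 0 := fun h => hx (by simpa using congrArg Complex.re h)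
  rw [contourQuot_of_ne hw, norm_div, contourBound]
  have e1 : ‖cexp (a * (x + y * I))‖ = rexp (a * x) := by simp [Complex.norm_exp]
  have e2 : ‖cexp ((x + y * I) / 2)‖ = rexp (x / 2) := by simp [Complex.norm_exp]
  have e3 : ‖cexp (x + y * I)‖ = rexp x := by simp [Complex.norm_exp]
  have d1 : |rexp (a * x) - κ| ≤ ‖cexp (a * (x + y * I)) + κ‖ := by
    have := abs_norm_sub_norm_le (cexp (a * (x + y * I))) (-κ)
    rwa [e1, norm_neg, sub_neg_eq_add, norm_real, Real.norm_of_nonneg hκ.le] at this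
  have d2 : |rexp x - 1| ≤ ‖cexp (x + y * I) - 1‖ := by
    have := abs_norm_sub_norm_le (cexp (x + y * I)) 1
    rwa [e3, norm_one] at this
  have p1 : 0 < |rexp (a * x) - κ| := abs_pos.2 (sub_ne_zero.2 hxκ)
  have p2 : 0 < |rexp x - 1| := abs_pos.2 (sub_ne_zero.2 (by simpa using hx))
  refine div_le_div₀ (by positivity) ?_ p2 d2
  refine (norm_sub_le _ _).trans (add_le_add ?_ ?_)
  · rw [norm_div, e1]
    exact div_le_div_of_nonneg_left (Real.exp_pos _).le p1 d1
  · rw [norm_mul, e2]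
    have : ‖(1 / (1 + κ) : ℂ)‖ = 1 / (1 + κ) := by
      rw [show (1 / (1 + κ) : ℂ) = ((1 / (1 + κ) : ℝ) : ℂ) by push_cast; rfl, norm_real,
        Real.norm_of_nonneg (by positivity)]
    rw [this]

lemma tendsto_contourBound_atBot {a κ : ℝ} (ha : 0 < a) (hκ : 0 < κ) :
    Tendsto (contourBound a κ) atBot (𝓝 0) := by
  have h1 : Tendsto (fun x => rexp (a * x)) atBot (𝓝 0) :=
    Real.tendsto_exp_atBot.comp (tendsto_id.const_mul_atBot ha)
  have h2 : Tendsto (fun x => rexp (x / 2)) atBot (𝓝 0) :=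
    Real.tendsto_exp_atBot.comp (tendsto_id.atBot_div_const two_pos)
  have := ((h1.div (h1.sub_const κ).abs (by simpa using hκ.ne')).add
    (h2.const_mul (1 / (1 + κ)))).div (Real.tendsto_exp_atBot.sub_const 1).abs (by simp)
  rw [zero_div, mul_zero, zero_add, zero_div] at this
  exact this

lemma tendsto_contourBound_atTop {a κ : ℝ} (ha : 0 < a) :
    Tendsto (contourBound a κ) atTop (𝓝 0) := by
  have h1 : Tendsto (fun x => rexp (-(a * x))) atTop (𝓝 0) :=
    Real.tendsto_exp_neg_atTop_nhds_zero.comp (tendsto_id.const_mul_atTop ha)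
  have h2 : Tendsto (fun x => rexp (-(x / 2))) atTop (𝓝 0) :=
    Real.tendsto_exp_neg_atTop_nhds_zero.comp (tendsto_id.atTop_div_const two_pos)
  have h3 := Real.tendsto_exp_neg_atTop_nhds_zero
  have := (((h3.div ((h1.const_mul κ).const_sub 1).abs (by simp)).add
    (h2.const_mul (1 / (1 + κ)))).div (h3.const_sub 1).abs (by simp))
  have h0 : (0 / |1 - κ * 0| + 1 / (1 + κ) * 0) / |1 - 0| = (0 : ℝ) := by simp
  rw [h0] at this
  refine this.congr fun x => ?_
  simp only [Pi.div_apply, contourBound]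
  have k1 : |1 - κ * rexp (-(a * x))| = |rexp (a * x) - κ| * rexp (-(a * x)) := by
    rw [← abs_of_pos (Real.exp_pos (-(a * x))), ← abs_mul, abs_of_pos (Real.exp_pos (-(a * x))),
      sub_mul, ← Real.exp_add]
    simp
  have k2 : |1 - rexp (-x)| = |rexp x - 1| * rexp (-x) := by
    rw [← abs_of_pos (Real.exp_pos (-x)), ← abs_mul, abs_of_pos (Real.exp_pos (-x)),
      sub_mul, ← Real.exp_add]
    simp
  have k3 : rexp (-(x / 2)) = rexp (x / 2) * rexp (-x) := by
    rw [← Real.exp_add]; congr 1; ring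
  rw [k1, k2, k3, Real.exp_neg (a * x)]
  have := Real.exp_pos (-x)
  have := Real.exp_pos (a * x)
  rw [← mul_assoc, div_mul_eq_div_div_swap (rexp (-x)), div_inv_eq_mul]
  rw [show rexp (-x) * rexp (a * x) / |rexp (a * x) - κ|
      = rexp (a * x) / |rexp (a * x) - κ| * rexp (-x) by ring, ← add_mul]
  exact mul_div_mul_right _ _ (Real.exp_pos (-x)).ne'

/-- The Poisson-type kernel produced by the jump of `e^{aw}/(e^{aw}+κ)` across `Im w = ±π`. -/
noncomputable def jumpKernel (a κ x : ℝ) : ℝ :=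
  κ * Real.sin (π * a) * rexp (a * x) /
    (rexp (a * x) ^ 2 + 2 * κ * Real.cos (π * a) * rexp (a * x) + κ ^ 2)

lemma sq_add_two_mul_cos_add_sq_pos {κ θ : ℝ} (hκ : 0 < κ) (hθ : 0 < Real.sin θ) (u : ℝ) :
    0 < u ^ 2 + 2 * κ * Real.cos θ * u + κ ^ 2 := by
  have h : u ^ 2 + 2 * κ * Real.cos θ * u + κ ^ 2
      = (u + κ * Real.cos θ) ^ 2 + (κ * Real.sin θ) ^ 2 := by
    linear_combination (-κ ^ 2) * Real.sin_sq_add_cos_sq θ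
  rw [h]; positivity

lemma sin_pi_mul_pos {a : ℝ} (ha : 0 < a) (ha' : a < 1) : 0 < Real.sin (π * a) :=
  Real.sin_pos_of_pos_of_lt_pi (by positivity) (by nlinarith [Real.pi_pos])

lemma contourQuot_sub {a κ : ℝ} (ha : 0 < a) (ha' : a < 1) (hκ : 0 < κ) (x : ℝ) :
    contourQuot a κ (x + (-π : ℝ) * I) - contourQuot a κ (x + (π : ℝ) * I) =
      2 * I * ((jumpKernel a κ x / (rexp x + 1) -
        1 / (1 + κ) * (rexp (x / 2) / (rexp x + 1)) : ℝ) : ℂ) := by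
  have hw1 : (x + (-π : ℝ) * I : ℂ) ≠ 0 := fun h =>
    Real.pi_ne_zero (by simpa using congrArg Complex.im h)
  have hw2 : (x + (π : ℝ) * I : ℂ) ≠ 0 := fun h =>
    Real.pi_ne_zero (by simpa using congrArg Complex.im h)
  rw [contourQuot_of_ne hw1, contourQuot_of_ne hw2]
  have n1 : cexp (a * (x + (-π : ℝ) * I)) + κ ≠ 0 := exp_add_ofReal_ne_zero hκ (by
    simp only [mul_im, ofReal_re, ofReal_im, add_im, I_im, I_re]
    rw [abs_lt]; constructor <;> ring_nf <;> nlinarith [Real.pi_pos])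
  have n2 : cexp (a * (x + (π : ℝ) * I)) + κ ≠ 0 := exp_add_ofReal_ne_zero hκ (by
    simp only [mul_im, ofReal_re, ofReal_im, add_im, I_im, I_re]
    rw [abs_lt]; constructor <;> ring_nf <;> nlinarith [Real.pi_pos])
  have e1 : cexp (a * (x + (-π : ℝ) * I)) =
      rexp (a * x) * (Real.cos (π * a) - Real.sin (π * a) * I) := by
    rw [show (a * (x + (-π : ℝ) * I) : ℂ) = (a * x : ℝ) + (-(π * a) : ℝ) * I by push_cast; ring,
      Complex.exp_add, Complex.exp_mul_I, ← ofReal_exp, ← ofReal_cos, ← ofReal_sin, Real.cos_neg,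
      Real.sin_neg]
    push_cast; ring
  have e2 : cexp (a * (x + (π : ℝ) * I)) =
      rexp (a * x) * (Real.cos (π * a) + Real.sin (π * a) * I) := by
    rw [show (a * (x + (π : ℝ) * I) : ℂ) = (a * x : ℝ) + (π * a : ℝ) * I by push_cast; ring,
      Complex.exp_add, Complex.exp_mul_I, ← ofReal_exp, ← ofReal_cos, ← ofReal_sin]
  have e3 : cexp ((x + (-π : ℝ) * I) / 2) = -I * rexp (x / 2) := by
    rw [show ((x + (-π : ℝ) * I) / 2 : ℂ) = (x / 2 : ℝ) + (-π / 2) * I by push_cast; ring,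
      Complex.exp_add, Complex.exp_neg_pi_div_two_mul_I, ← ofReal_exp]
    ring
  have e4 : cexp ((x + (π : ℝ) * I) / 2) = I * rexp (x / 2) := by
    rw [show ((x + (π : ℝ) * I) / 2 : ℂ) = (x / 2 : ℝ) + (π / 2) * I by push_cast; ring,
      Complex.exp_add, Complex.exp_pi_div_two_mul_I, ← ofReal_exp]
    ring
  have e5 : cexp (x + (-π : ℝ) * I) = -rexp x := by
    rw [show (x + (-π : ℝ) * I : ℂ) = x - π * I by push_cast; ring,
      Complex.exp_sub, Complex.exp_pi_mul_I, ← ofReal_exp, div_neg, div_one]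
  have e6 : cexp (x + (π : ℝ) * I) = -rexp x := by
    rw [Complex.exp_add, Complex.exp_pi_mul_I, ← ofReal_exp]
    simp
  rw [contourNum, contourNum, e3, e4, e5, e6]
  rw [e1] at n1 ⊢
  rw [e2] at n2 ⊢
  have q : ((rexp x : ℂ) + 1) ≠ 0 := by
    have : rexp x + 1 ≠ 0 := by positivity
    exact_mod_cast this
  have hk : (1 + κ : ℂ) ≠ 0 := by
    have : 1 + κ ≠ 0 := by positivity
    exact_mod_cast this
  have hsc : (Real.sin (π * a) : ℂ) ^ 2 + (Real.cos (π * a) : ℂ) ^ 2 = 1 := by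
    exact_mod_cast Real.sin_sq_add_cos_sq (π * a)
  have hD : ((rexp (a * x) : ℂ) ^ 2 + 2 * κ * Real.cos (π * a) * rexp (a * x) + κ ^ 2) =
      (rexp (a * x) * (Real.cos (π * a) - Real.sin (π * a) * I) + κ) *
      (rexp (a * x) * (Real.cos (π * a) + Real.sin (π * a) * I) + κ) := by
    linear_combination (-(rexp (a * x) : ℂ) ^ 2) * hsc
      + (Real.sin (π * a) : ℂ) ^ 2 * (rexp (a * x) : ℂ) ^ 2 * I_sq
  simp only [jumpKernel, ofReal_sub, ofReal_div, ofReal_mul, ofReal_add, ofReal_pow, ofReal_one,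
    ofReal_ofNat]
  rw [hD, show (-(rexp x : ℂ) - 1) = -(rexp x + 1) by ring]
  generalize (rexp x : ℂ) = E at *
  generalize (rexp (a * x) : ℂ) = F at *
  generalize (Real.cos (π * a) : ℂ) = c at *
  generalize (Real.sin (π * a) : ℂ) = s at *
  have key : F * (c - s * I) / (F * (c - s * I) + κ) - F * (c + s * I) / (F * (c + s * I) + κ)
      = - (2 * I * (κ * s * F / ((F * (c - s * I) + κ) * (F * (c + s * I) + κ)))) := by
    rw [div_sub_div _ _ n1 n2, mul_div_assoc', ← neg_div]
    congr 1; ring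
  rw [div_neg, div_neg, neg_sub_neg, ← sub_div, ← neg_sub]
  rw [show F * (c - s * I) / (F * (c - s * I) + κ) - 1 / (1 + κ) * (-I * (rexp (x / 2) : ℂ)) -
      (F * (c + s * I) / (F * (c + s * I) + κ) - 1 / (1 + κ) * (I * (rexp (x / 2) : ℂ))) =
      (F * (c - s * I) / (F * (c - s * I) + κ) - F * (c + s * I) / (F * (c + s * I) + κ))
      + 2 * I * (1 / (1 + κ) * rexp (x / 2)) by ring, key]
  ring

lemma continuous_jumpKernel_div {a κ : ℝ} (ha : 0 < a) (ha' : a < 1) (hκ : 0 < κ) :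
    Continuous fun x => jumpKernel a κ x / (rexp x + 1) := by
  unfold jumpKernel
  refine Continuous.div (Continuous.div (by fun_prop) (by fun_prop) fun x => ?_) (by fun_prop)
    fun x => by positivity
  exact (sq_add_two_mul_cos_add_sq_pos hκ (sin_pi_mul_pos ha ha') _).ne'

lemma norm_intervalIntegral_jumpKernel_sub_le {a κ R : ℝ} (ha : 0 < a) (ha' : a < 1) (hκ : 0 < κ)
    (hR : 0 < R) (h1 : rexp (a * R) ≠ κ) (h2 : rexp (a * -R) ≠ κ) :
    |(∫ x in -R..R, jumpKernel a κ x / (rexp x + 1)) -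
      1 / (1 + κ) * ∫ x in -R..R, rexp (x / 2) / (rexp x + 1)|
      ≤ π * (contourBound a κ R + contourBound a κ (-R)) := by
  have hc2 : Continuous fun x : ℝ => rexp (x / 2) / (rexp x + 1) :=
    Continuous.div (by fun_prop) (by fun_prop) fun x => by positivity
  rw [← intervalIntegral.integral_const_mul, ← intervalIntegral.integral_sub
    ((continuous_jumpKernel_div ha ha' hκ).intervalIntegrable _ _)
    ((hc2.const_mul _).intervalIntegrable _ _)]
  have hdiff : DifferentiableOn ℂ (contourQuot a κ) ([[-R, R]] ×ℂ [[-π, π]]) := by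
    refine (differentiableOn_contourQuot hκ).mono fun w hw => ?_
    have := hw.2
    rw [mem_preimage, uIcc_of_le (by linarith [Real.pi_pos]), mem_Icc, ← abs_le] at this
    refine ⟨by linarith [Real.pi_pos], ?_⟩
    rw [abs_mul, abs_of_pos ha]
    nlinarith [Real.pi_pos]
  have hrect := Complex.integral_boundary_rect_eq_zero_of_differentiableOn (contourQuot a κ)
    ⟨-R, -π⟩ ⟨R, π⟩ hdiff
  have hcont : ∀ y ∈ [[-π, π]], IntervalIntegrable
      (fun x : ℝ => contourQuot a κ (x + y * I)) volume (-R) R := fun y hy =>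
    (hdiff.continuousOn.comp (by fun_prop) fun x hx => by
      simpa [Complex.mem_reProdIm] using ⟨hx, hy⟩).intervalIntegrable
  simp only at hrect
  rw [← intervalIntegral.integral_sub (hcont _ left_mem_uIcc) (hcont _ right_mem_uIcc)] at hrect
  simp_rw [contourQuot_sub ha ha' hκ] at hrect
  rw [intervalIntegral.integral_const_mul, intervalIntegral.integral_ofReal] at hrect
  have b1 : ‖∫ y in -π..π, contourQuot a κ ((R : ℝ) + y * I)‖ ≤ contourBound a κ R * |π - -π| :=
    intervalIntegral.norm_integral_le_of_norm_le_const fun y _ =>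
      norm_contourQuot_le hκ hR.ne' h1 y
  have b2 : ‖∫ y in -π..π, contourQuot a κ ((-R : ℝ) + y * I)‖ ≤
      contourBound a κ (-R) * |π - -π| :=
    intervalIntegral.norm_integral_le_of_norm_le_const fun y _ =>
      norm_contourQuot_le hκ (by linarith) h2 y
  rw [abs_of_pos (by linarith [Real.pi_pos])] at b1 b2
  set V := ∫ x in -R..R, (jumpKernel a κ x / (rexp x + 1) -
        1 / (1 + κ) * (rexp (x / 2) / (rexp x + 1)))
  set A := ∫ y in -π..π, contourQuot a κ ((R : ℝ) + y * I)
  set B := ∫ y in -π..π, contourQuot a κ ((-R : ℝ) + y * I)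
  have hV : ((2 * V : ℝ) : ℂ) = B - A := by
    have : I * ((2 * V : ℝ) : ℂ) = I * (B - A) := by
      push_cast
      simp only [smul_eq_mul] at hrect
      linear_combination hrect
    exact mul_left_cancel₀ I_ne_zero this
  have h3 : |2 * V| ≤ ‖B‖ + ‖A‖ := by
    rw [← Real.norm_eq_abs, ← norm_real, hV]; exact norm_sub_le _ _
  rw [abs_mul, abs_two] at h3
  linarith

lemma intervalIntegral_exp_half_div (R : ℝ) :
    ∫ x in -R..R, rexp (x / 2) / (rexp x + 1) =
      2 * Real.arctan (rexp (R / 2)) - 2 * Real.arctan (rexp (-R / 2)) := by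
  refine intervalIntegral.integral_eq_sub_of_hasDerivAt
    (f := fun x => 2 * Real.arctan (rexp (x / 2))) (fun x _ => ?_) ?_
  · have h := (((hasDerivAt_id x).div_const 2).exp.arctan).const_mul 2
    convert! h using 1
    rw [← Real.exp_nat_mul]
    simp only [id, Nat.cast_ofNat, mul_div_cancel₀ x (two_ne_zero' ℝ)]
    rw [add_comm (1 : ℝ)]
    field_simp
  · exact (Continuous.div (by fun_prop) (by fun_prop) fun x => by positivity).intervalIntegrable _ _

lemma tendsto_intervalIntegral_exp_half_div :
    Tendsto (fun R : ℝ => ∫ x in -R..R, rexp (x / 2) / (rexp x + 1)) atTop (𝓝 π) := by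
  simp_rw [intervalIntegral_exp_half_div]
  have h1 : Tendsto (fun R : ℝ => Real.arctan (rexp (R / 2))) atTop (𝓝 (π / 2)) :=
    (Real.tendsto_arctan_atTop.mono_right nhdsWithin_le_nhds).comp
      (Real.tendsto_exp_atTop.comp (tendsto_id.atTop_div_const two_pos))
  have h2 : Tendsto (fun R : ℝ => Real.arctan (rexp (-R / 2))) atTop (𝓝 (Real.arctan 0)) :=
    (Real.continuous_arctan.tendsto 0).comp
      (Real.tendsto_exp_atBot.comp (tendsto_neg_atTop_atBot.atBot_div_const two_pos))
  have := (h1.const_mul 2).sub (h2.const_mul 2)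
  rwa [Real.arctan_zero, mul_zero, sub_zero, mul_div_cancel₀ π (two_ne_zero' ℝ)] at this

lemma tendsto_intervalIntegral_jumpKernel {a κ : ℝ} (ha : 0 < a) (ha' : a < 1) (hκ : 0 < κ) :
    Tendsto (fun R : ℝ => ∫ x in -R..R, jumpKernel a κ x / (rexp x + 1)) atTop
      (𝓝 (1 / (1 + κ) * π)) := by
  have hB : Tendsto (fun R : ℝ => π * (contourBound a κ R + contourBound a κ (-R))) atTop (𝓝 0) := by
    simpa using ((tendsto_contourBound_atTop (κ := κ) ha).add
      ((tendsto_contourBound_atBot ha hκ).comp tendsto_neg_atTop_atBot)).const_mul π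
  have hd : Tendsto (fun R : ℝ => (∫ x in -R..R, jumpKernel a κ x / (rexp x + 1)) -
      1 / (1 + κ) * ∫ x in -R..R, rexp (x / 2) / (rexp x + 1)) atTop (𝓝 0) := by
    refine squeeze_zero_norm' ?_ hB
    have h1 : Tendsto (fun R => rexp (a * R)) atTop atTop :=
      Real.tendsto_exp_atTop.comp (tendsto_id.const_mul_atTop ha)
    have h2 : Tendsto (fun R => rexp (a * -R)) atTop (𝓝 0) :=
      Real.tendsto_exp_atBot.comp (tendsto_neg_atTop_atBot.const_mul_atBot ha)
    filter_upwards [eventually_gt_atTop 0, h1.eventually_ne_atTop κ,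
      h2.eventually_ne hκ.ne] with R hR hR1 hR2
    exact norm_intervalIntegral_jumpKernel_sub_le ha ha' hκ hR hR1 hR2
  simpa using hd.add (tendsto_intervalIntegral_exp_half_div.const_mul (1 / (1 + κ)))

lemma integrable_jumpKernel_div {a κ : ℝ} (ha : 0 < a) (ha' : a < 1) (hκ : 0 < κ) :
    Integrable fun x => jumpKernel a κ x / (rexp x + 1) := by
  refine integrable_of_intervalIntegral_norm_tendsto (l := atTop) (a := fun R : ℝ => -R)
    (b := fun R => R) (1 / (1 + κ) * π)
    (fun R => ((continuous_jumpKernel_div ha ha' hκ).integrableOn_Icc).mono_set Ioc_subset_Icc_self)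
    tendsto_neg_atTop_atBot tendsto_id ?_
  refine (tendsto_intervalIntegral_jumpKernel ha ha' hκ).congr fun R => ?_
  refine intervalIntegral.integral_congr fun x _ => (Real.norm_of_nonneg ?_).symm
  have := sq_add_two_mul_cos_add_sq_pos hκ (sin_pi_mul_pos ha ha') (rexp (a * x))
  have := sin_pi_mul_pos ha ha'
  unfold jumpKernel
  positivity

lemma integral_jumpKernel_div {a κ : ℝ} (ha : 0 < a) (ha' : a < 1) (hκ : 0 < κ) :
    ∫ x, jumpKernel a κ x / (rexp x + 1) = 1 / (1 + κ) * π :=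
  tendsto_nhds_unique
    (intervalIntegral_tendsto_integral (integrable_jumpKernel_div ha ha' hκ)
      tendsto_neg_atTop_atBot tendsto_id)
    (tendsto_intervalIntegral_jumpKernel ha ha' hκ)

end Contour

section Laplace

open Set

/-- The density of the Stieltjes representation of `ζ ↦ ζ^(a-1) / (ζ^a + κ)`, up to a constant. -/
noncomputable def stieltjesDensity (a κ r : ℝ) : ℝ :=
  r ^ (a - 1) / (r ^ (2 * a) + 2 * κ * Real.cos (π * a) * r ^ a + κ ^ 2)

lemma stieltjesDensity_nonneg {a κ r : ℝ} (ha : 0 < a) (ha' : a < 1) (hκ : 0 < κ) (hr : 0 < r) :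
    0 ≤ stieltjesDensity a κ r := by
  have := sq_add_two_mul_cos_add_sq_pos hκ (sin_pi_mul_pos ha ha') (r ^ a)
  rw [← Real.rpow_mul_natCast hr.le, Nat.cast_ofNat, mul_comm a 2] at this
  unfold stieltjesDensity
  positivity

lemma measurable_stieltjesDensity (a κ : ℝ) : Measurable (stieltjesDensity a κ) := by
  unfold stieltjesDensity
  fun_prop

lemma stieltjesDensity_comp_exp {a κ ζ : ℝ} (ha : 0 < a) (ha' : a < 1) (hκ : 0 < κ) (hζ : 0 < ζ)
    (x : ℝ) :
    |ζ * rexp x| • (stieltjesDensity a κ (ζ * rexp x) / (ζ * rexp x + ζ)) =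
      1 / (ζ * κ * Real.sin (π * a)) * (jumpKernel a (κ / ζ ^ a) x / (rexp x + 1)) := by
  have hE := Real.exp_pos x
  have hF := Real.exp_pos (a * x)
  have hZ : 0 < ζ ^ a := Real.rpow_pos_of_pos hζ a
  have hs := sin_pi_mul_pos ha ha'
  have hD := sq_add_two_mul_cos_add_sq_pos (div_pos hκ hZ) hs (rexp (a * x))
  have e1 : (ζ * rexp x) ^ a = ζ ^ a * rexp (a * x) := by
    rw [Real.mul_rpow hζ.le hE.le, ← Real.exp_mul, mul_comm x a]
  have e2 : (ζ * rexp x) ^ (a - 1) = ζ ^ a * rexp (a * x) / (ζ * rexp x) := by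
    rw [Real.rpow_sub_one (by positivity), e1]
  have e3 : (ζ * rexp x) ^ (2 * a) = (ζ ^ a * rexp (a * x)) ^ 2 := by
    rw [← e1, ← Real.rpow_mul_natCast (by positivity), Nat.cast_ofNat, mul_comm a 2]
  have e4 : (ζ ^ a * rexp (a * x)) ^ 2 + 2 * κ * Real.cos (π * a) * (ζ ^ a * rexp (a * x)) + κ ^ 2
      = (ζ ^ a) ^ 2 * (rexp (a * x) ^ 2 + 2 * (κ / ζ ^ a) * Real.cos (π * a) * rexp (a * x)
        + (κ / ζ ^ a) ^ 2) := by
    field_simp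
  rw [smul_eq_mul, abs_of_pos (by positivity), stieltjesDensity, jumpKernel, e2, e3, e1, e4]
  generalize rexp (a * x) ^ 2 + 2 * (κ / ζ ^ a) * Real.cos (π * a) * rexp (a * x)
        + (κ / ζ ^ a) ^ 2 = D at *
  generalize Real.sin (π * a) = s at *
  field_simp

lemma image_const_mul_exp_univ {ζ : ℝ} (hζ : 0 < ζ) : (fun x => ζ * rexp x) '' univ = Ioi 0 := by
  ext r
  simp only [image_univ, mem_range, mem_Ioi]
  constructor
  · rintro ⟨x, rfl⟩
    positivity
  · intro hr
    refine ⟨Real.log (r / ζ), ?_⟩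
    rw [Real.exp_log (by positivity), mul_div_cancel₀ _ hζ.ne']

lemma hasDerivWithinAt_const_mul_exp (ζ x : ℝ) (s : Set ℝ) :
    HasDerivWithinAt (fun x => ζ * rexp x) (ζ * rexp x) s x :=
  ((Real.hasDerivAt_exp x).const_mul ζ).hasDerivWithinAt

lemma injOn_const_mul_exp {ζ : ℝ} (hζ : 0 < ζ) (s : Set ℝ) : InjOn (fun x => ζ * rexp x) s :=
  ((mul_right_injective₀ hζ.ne').comp Real.exp_injective).injOn

lemma integrableOn_stieltjesDensity_div {a κ ζ : ℝ} (ha : 0 < a) (ha' : a < 1) (hκ : 0 < κ)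
    (hζ : 0 < ζ) : IntegrableOn (fun r => stieltjesDensity a κ r / (r + ζ)) (Ioi 0) := by
  rw [← image_const_mul_exp_univ hζ, integrableOn_image_iff_integrableOn_abs_deriv_smul .univ
    (fun x _ => hasDerivWithinAt_const_mul_exp ζ x _) (injOn_const_mul_exp hζ _)]
  simp_rw [stieltjesDensity_comp_exp ha ha' hκ hζ]
  rw [integrableOn_univ]
  exact (integrable_jumpKernel_div ha ha' (by positivity)).const_mul _

/-- The Stieltjes representation of `ζ^(a-1) / (ζ^a + κ)`. -/
lemma integral_stieltjesDensity_div {a κ ζ : ℝ} (ha : 0 < a) (ha' : a < 1) (hκ : 0 < κ)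
    (hζ : 0 < ζ) : ∫ r in Ioi 0, stieltjesDensity a κ r / (r + ζ) =
      π / (ζ * κ * Real.sin (π * a)) * (ζ ^ a / (ζ ^ a + κ)) := by
  rw [← image_const_mul_exp_univ hζ, integral_image_eq_integral_abs_deriv_smul .univ
    (fun x _ => hasDerivWithinAt_const_mul_exp ζ x _) (injOn_const_mul_exp hζ _)]
  simp_rw [stieltjesDensity_comp_exp ha ha' hκ hζ]
  have hZ : 0 < ζ ^ a := Real.rpow_pos_of_pos hζ a
  have hs := sin_pi_mul_pos ha ha'
  rw [setIntegral_univ, integral_const_mul, integral_jumpKernel_div ha ha' (by positivity)]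
  field_simp

lemma integral_exp_neg_mul_Ioi_zero {b : ℝ} (hb : 0 < b) :
    ∫ x in Ioi (0 : ℝ), rexp (-b * x) = 1 / b := by
  rw [integral_exp_mul_Ioi (by linarith)]
  simp

lemma integrable_exp_mul_stieltjesDensity {a κ ζ : ℝ} (ha : 0 < a) (ha' : a < 1) (hκ : 0 < κ)
    (hζ : 0 < ζ) : Integrable (fun p : ℝ × ℝ => rexp (-(p.2 + ζ) * p.1) * stieltjesDensity a κ p.2)
      ((volume.restrict (Ioi 0)).prod (volume.restrict (Ioi 0))) := by
  have hm := measurable_stieltjesDensity a κ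
  rw [integrable_prod_iff' (by fun_prop)]
  constructor
  · filter_upwards [ae_restrict_mem measurableSet_Ioi] with r hr
    exact (exp_neg_integrableOn_Ioi 0 (add_pos hr hζ)).mul_const _
  · refine (integrableOn_stieltjesDensity_div ha ha' hκ hζ).congr ?_
    filter_upwards [ae_restrict_mem measurableSet_Ioi] with r hr
    simp_rw [norm_mul, Real.norm_of_nonneg (Real.exp_pos _).le,
      Real.norm_of_nonneg (stieltjesDensity_nonneg ha ha' hκ hr)]
    rw [integral_mul_const, integral_exp_neg_mul_Ioi_zero (add_pos hr hζ)]
    ring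

end Laplace

/-- For `0 < a < 1` and `κ > 0`, the function
`v̄(x) = (1-a) + (2aκ sin(πa)/π) ∫_0^∞ e^{-rx} r^{a-1}/(r^{2a} + 2κ cos(πa) r^a + κ²) dr`
has Laplace transform `(1/ζ)[1 + a (ζ^a - κ)/(ζ^a + κ)]` for every `ζ > 0`. -/
theorem laplace_transform_of_vbar (a κ : ℝ) (ha : 0 < a) (ha' : a < 1) (hκ : 0 < κ) :
    ∀ ζ : ℝ, 0 < ζ →
      (∫ x in Set.Ioi (0:ℝ),
          ((1 - a) + (2*a*κ*Real.sin (π*a)/π) *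
            ∫ r in Set.Ioi (0:ℝ),
              Real.exp (-(r*x)) * r ^ (a-1) /
                (r ^ (2*a) + 2*κ*Real.cos (π*a) * r ^ a + κ^2)) * Real.exp (-(ζ*x)))
        = (1/ζ) * (1 + a * ((ζ ^ a - κ)/(ζ ^ a + κ))) := by
  intro ζ hζ
  have hint := integrable_exp_mul_stieltjesDensity ha ha' hκ hζ
  have hsplit : ∀ x : ℝ, ((1 - a) + (2*a*κ*Real.sin (π*a)/π) *
      ∫ r in Set.Ioi (0:ℝ), Real.exp (-(r*x)) * r ^ (a-1) /
        (r ^ (2*a) + 2*κ*Real.cos (π*a) * r ^ a + κ^2)) * Real.exp (-(ζ*x)) =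
      (1 - a) * rexp (-ζ * x) + (2*a*κ*Real.sin (π*a)/π) *
        ∫ r in Set.Ioi (0:ℝ), rexp (-(r + ζ) * x) * stieltjesDensity a κ r := by
    intro x
    rw [add_mul, mul_assoc (2*a*κ*Real.sin (π*a)/π), ← integral_mul_const, neg_mul]
    congr 3 with r
    rw [stieltjesDensity, show -(r + ζ) * x = -(r * x) + -(ζ * x) by ring, Real.exp_add]
    ring
  simp_rw [hsplit]
  rw [integral_add ((exp_neg_integrableOn_Ioi 0 hζ).const_mul _)
    (hint.integral_prod_left.const_mul _), integral_const_mul, integral_const_mul,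
    integral_exp_neg_mul_Ioi_zero hζ, integral_integral_swap hint,
    setIntegral_congr_fun (g := fun r => stieltjesDensity a κ r / (r + ζ)) measurableSet_Ioi
      (fun r hr => ?_), integral_stieltjesDensity_div ha ha' hκ hζ]
  · have hZ : 0 < ζ ^ a := Real.rpow_pos_of_pos hζ a
    have hs := sin_pi_mul_pos ha ha'
    generalize Real.sin (π * a) = s at *
    field_simp
    ring
  · simp only
    rw [integral_mul_const, integral_exp_neg_mul_Ioi_zero (add_pos hr hζ)]
    ring
end

section
/- Let $0<a<1$ and $\kappa>0$, and let $\bar v(x)=(1-a)+\frac{2a\kappa\sin(\pi a)}{\pi}\int_0^\infty \frac{e^{-rx}\,r^{a-1}}{r^{2a}+2\kappa\cos(\pi a)\,r^{a}+\kappa^2}\,dr$ for $x>0$. Then $\bar v$ is differentiable with $\bar v'(x)<0$ for all $x>0$; consequently $\bar h(x):=-x\,\bar v'(x)>0$ and $\bar u(x):=-\bar v(x)+\frac{1}{x}\int_0^x\bar v(z)\,dz>0$ for all $x>0$. -/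
open MeasureTheory Real

/-- The derivative of the Laplace transform of an integrable weight on `(0, ∞)`. -/
lemma hasDerivAt_laplace {w : ℝ → ℝ} (hw : IntegrableOn w (Set.Ioi 0)) {x : ℝ} (hx : 0 < x) :
    IntegrableOn (fun r => -r * (exp (-(r * x)) * w r)) (Set.Ioi 0) ∧
    HasDerivAt (fun x => ∫ r in Set.Ioi (0:ℝ), exp (-(r * x)) * w r)
      (∫ r in Set.Ioi (0:ℝ), -r * (exp (-(r * x)) * w r)) x := by
  refine hasDerivAt_integral_of_dominated_loc_of_deriv_le (μ := volume.restrict (Set.Ioi 0))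
    (F := fun x r => exp (-(r * x)) * w r) (F' := fun x r => -r * (exp (-(r * x)) * w r))
    (bound := fun r => 2 / x * ‖w r‖) (s := Set.Ioi (x / 2))
    (Ioi_mem_nhds (by linarith)) ?_ ?_ ?_ ?_ ?_ ?_
  · refine Filter.Eventually.of_forall fun y => ?_
    exact (by fun_prop : Continuous fun r : ℝ => exp (-(r * y))).aestronglyMeasurable.mul
      hw.aestronglyMeasurable
  · refine hw.norm.mono' ?_ ?_
    · exact (by fun_prop : Continuous fun r : ℝ => exp (-(r * x))).aestronglyMeasurable.mul
        hw.aestronglyMeasurable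
    · filter_upwards [ae_restrict_mem measurableSet_Ioi] with r hr
      have hr : 0 < r := hr
      rw [norm_mul, norm_eq_abs, abs_exp]
      exact mul_le_of_le_one_left (norm_nonneg _) (exp_le_one_iff.2 (by nlinarith))
  · exact (by fun_prop : Continuous fun r : ℝ => -r).aestronglyMeasurable.mul
      ((by fun_prop : Continuous fun r : ℝ => exp (-(r * x))).aestronglyMeasurable.mul
        hw.aestronglyMeasurable)
  · filter_upwards [ae_restrict_mem measurableSet_Ioi] with r hr y hy
    have hr : 0 < r := hr
    have hy : x / 2 < y := hy
    rw [norm_mul, norm_mul, ← mul_assoc, norm_neg, norm_eq_abs r, abs_of_pos hr,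
      norm_eq_abs (exp _), abs_exp]
    gcongr
    rw [exp_neg, ← div_eq_mul_inv, div_le_div_iff₀ (exp_pos _) hx]
    have := add_one_le_exp (r * y)
    nlinarith
  · exact hw.norm.const_mul _
  · refine Filter.Eventually.of_forall fun r y _ => ?_
    have h : HasDerivAt (fun y => -(r * y)) (-r) y := by
      simp only [← neg_mul]
      simpa using (hasDerivAt_id y).const_mul (-r)
    exact (h.exp.mul_const (w r)).congr_deriv (by ring)

/-- The derivative of the Laplace transform of a positive weight is negative. -/
lemma deriv_laplace_neg {w : ℝ → ℝ} (hw : IntegrableOn w (Set.Ioi 0))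
    (hpos : ∀ r, 0 < r → 0 < w r) {x : ℝ} (hx : 0 < x) :
    ∫ r in Set.Ioi (0:ℝ), -r * (exp (-(r * x)) * w r) < 0 := by
  have hint := (hasDerivAt_laplace hw hx).1.neg
  have hp : ∀ r ∈ Set.Ioi (0:ℝ), 0 < (-fun r => -r * (exp (-(r * x)) * w r)) r := by
    intro r hr
    have := hpos r hr
    have hr : 0 < r := hr
    have : 0 < r * (exp (-(r * x)) * w r) := by positivity
    simpa using this
  have h := (setIntegral_pos_iff_support_of_nonneg_ae
    ((ae_restrict_mem measurableSet_Ioi).mono fun r hr => (hp r hr).le) hint).2 (by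
      rw [Set.inter_eq_self_of_subset_right
        (fun r hr => Function.mem_support.2 (hp r hr).ne')]
      simp)
  rw [integral_neg'] at h
  linarith

/-- A bounded continuous strictly decreasing function exceeds its right endpoint value on
average. -/
lemma lt_average_of_strictAntiOn {v : ℝ → ℝ} (hc : ContinuousOn v (Set.Ioi 0))
    (ha : StrictAntiOn v (Set.Ioi 0)) {C : ℝ} (hC : ∀ z, 0 < z → |v z| ≤ C) {x : ℝ}
    (hx : 0 < x) : 0 < -v x + (1 / x) * ∫ z in Set.Ioo (0:ℝ) x, v z := by
  have hfin : volume (Set.Ioo 0 x) ≠ ⊤ := by simp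
  have hint : IntegrableOn v (Set.Ioo 0 x) := by
    have : IsFiniteMeasure (volume.restrict (Set.Ioo 0 x)) := ⟨by simp⟩
    refine Integrable.of_bound
      ((hc.mono fun z hz => hz.1).aestronglyMeasurable measurableSet_Ioo) C ?_
    filter_upwards [ae_restrict_mem measurableSet_Ioo] with z hz using hC z hz.1
  have hconst : IntegrableOn (fun _ => v x) (Set.Ioo 0 x) := integrableOn_const hfin
  have hp : ∀ z ∈ Set.Ioo 0 x, 0 < v z - v x := fun z hz => sub_pos.2 (ha hz.1 hx hz.2)
  have h := (setIntegral_pos_iff_support_of_nonneg_ae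
    ((ae_restrict_mem measurableSet_Ioo).mono fun z hz => (hp z hz).le) (hint.sub hconst)).2 (by
      rw [Set.inter_eq_self_of_subset_right
        (fun z hz => Function.mem_support.2 (hp z hz).ne')]
      simpa using hx)
  rw [integral_sub hint hconst, setIntegral_const] at h
  simp only [measureReal_def, volume_Ioo, sub_zero, ENNReal.toReal_ofReal hx.le,
    smul_eq_mul] at h
  have : -v x + (1 / x) * ∫ z in Set.Ioo (0:ℝ) x, v z
      = (1 / x) * ((∫ z in Set.Ioo (0:ℝ) x, v z) - x * v x) := by
    field_simp
    ring
  rw [this]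
  positivity

/-- A quadratic form `s² + 2κcs + κ²` with `|c| < 1` is coercive. -/
lemma mul_sq_add_sq_le_quadratic (κ c s : ℝ) :
    (1 - |c|) * (s ^ 2 + κ ^ 2) ≤ s ^ 2 + 2 * κ * c * s + κ ^ 2 := by
  rcases abs_cases c with ⟨h, h'⟩ | ⟨h, h'⟩ <;> rw [h]
  · nlinarith [mul_nonneg h' (sq_nonneg (s + κ))]
  · nlinarith [mul_nonneg (neg_nonneg.2 h'.le) (sq_nonneg (s - κ))]

/-- The kernel `r ^ (a-1) / (r ^ (2a) + 2κc r ^ a + κ²)` with `|c| < 1` is integrable on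
`(0, ∞)` and positive there. -/
lemma rpow_div_quadratic_integrableOn_and_pos {a κ c : ℝ} (ha : 0 < a) (hκ : 0 < κ)
    (hc : |c| < 1) :
    IntegrableOn (fun r : ℝ => r ^ (a-1) / (r ^ (2*a) + 2*κ*c * r ^ a + κ^2)) (Set.Ioi 0) ∧
    ∀ r : ℝ, 0 < r → 0 < r ^ (a-1) / (r ^ (2*a) + 2*κ*c * r ^ a + κ^2) := by
  have hd : 0 < 1 - |c| := sub_pos.2 hc
  have hD : ∀ r : ℝ, 0 < r → (1 - |c|) * (r ^ (2*a) + κ ^ 2) ≤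
      r ^ (2*a) + 2*κ*c * r ^ a + κ^2 := by
    intro r hr
    have h2 : r ^ (2*a) = (r ^ a) ^ 2 := by
      rw [mul_comm, rpow_mul hr.le]; norm_cast
    rw [h2]
    exact mul_sq_add_sq_le_quadratic κ c (r ^ a)
  have hD' : ∀ r : ℝ, 0 < r → 0 < r ^ (2*a) + 2*κ*c * r ^ a + κ^2 := fun r hr =>
    lt_of_lt_of_le (by positivity) (hD r hr)
  have hpos : ∀ r : ℝ, 0 < r → 0 < r ^ (a-1) / (r ^ (2*a) + 2*κ*c * r ^ a + κ^2) :=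
    fun r hr => div_pos (rpow_pos_of_pos hr _) (hD' r hr)
  refine ⟨?_, hpos⟩
  have hm : Measurable fun r : ℝ => r ^ (a-1) / (r ^ (2*a) + 2*κ*c * r ^ a + κ^2) := by
    fun_prop
  rw [← Set.Ioc_union_Ioi_eq_Ioi (zero_le_one' ℝ)]
  refine IntegrableOn.union ?_ ?_
  · have h1 : IntegrableOn (fun r : ℝ => r ^ (a-1)) (Set.Ioc 0 1) :=
      (intervalIntegrable_iff_integrableOn_Ioc_of_le zero_le_one).1
        (intervalIntegral.intervalIntegrable_rpow' (by linarith))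
    refine (h1.const_mul (1 / ((1 - |c|) * κ ^ 2))).mono' hm.aestronglyMeasurable ?_
    filter_upwards [ae_restrict_mem measurableSet_Ioc] with r hr
    have hr : 0 < r := hr.1
    rw [norm_eq_abs, abs_of_pos (hpos r hr), one_div_mul_eq_div]
    have := rpow_pos_of_pos hr (2 * a)
    gcongr
    exact le_trans (by nlinarith) (hD r hr)
  · have h1 : IntegrableOn (fun r : ℝ => r ^ (-a-1)) (Set.Ioi 1) :=
      integrableOn_Ioi_rpow_of_lt (by linarith) zero_lt_one
    refine (h1.const_mul (1 / (1 - |c|))).mono' hm.aestronglyMeasurable ?_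
    filter_upwards [ae_restrict_mem measurableSet_Ioi] with r hr
    have hr : 0 < r := zero_lt_one.trans hr
    rw [norm_eq_abs, abs_of_pos (hpos r hr), one_div_mul_eq_div, div_le_div_iff₀ (hD' r hr) hd]
    have h3 : r ^ (a-1) = r ^ (-a-1) * r ^ (2*a) := by
      rw [← rpow_add hr]; ring_nf
    rw [h3, mul_assoc]
    have := rpow_pos_of_pos hr (2 * a)
    gcongr
    exact le_trans (by nlinarith [sq_nonneg κ, mul_nonneg hd.le (sq_nonneg κ)]) (hD r hr)

/-- For `0 < a < 1` and `κ > 0`, the function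
`v̄(x) = (1-a) + (2aκ sin(πa)/π) ∫_0^∞ e^{-rx} r^{a-1}/(r^{2a} + 2κ cos(πa) r^a + κ²) dr`
is differentiable on `(0,∞)` with `v̄' < 0`; consequently `h̄(x) = -x v̄'(x) > 0` and
`ū(x) = -v̄(x) + (1/x)∫_0^x v̄ > 0` for all `x > 0`. -/
theorem vbar_decreasing (a κ : ℝ) (ha : 0 < a) (ha' : a < 1) (hκ : 0 < κ) :
    (∀ x : ℝ, 0 < x →
      DifferentiableAt ℝ (fun x : ℝ => (1 - a) + (2*a*κ*Real.sin (π*a)/π) *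
        ∫ r in Set.Ioi (0:ℝ),
          Real.exp (-(r*x)) * r ^ (a-1) /
            (r ^ (2*a) + 2*κ*Real.cos (π*a) * r ^ a + κ^2)) x ∧
      deriv (fun x : ℝ => (1 - a) + (2*a*κ*Real.sin (π*a)/π) *
        ∫ r in Set.Ioi (0:ℝ),
          Real.exp (-(r*x)) * r ^ (a-1) /
            (r ^ (2*a) + 2*κ*Real.cos (π*a) * r ^ a + κ^2)) x < 0) ∧
    (∀ x : ℝ, 0 < x →
      0 < -x * deriv (fun x : ℝ => (1 - a) + (2*a*κ*Real.sin (π*a)/π) *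
        ∫ r in Set.Ioi (0:ℝ),
          Real.exp (-(r*x)) * r ^ (a-1) /
            (r ^ (2*a) + 2*κ*Real.cos (π*a) * r ^ a + κ^2)) x) ∧
    (∀ x : ℝ, 0 < x →
      0 < -((1 - a) + (2*a*κ*Real.sin (π*a)/π) *
          ∫ r in Set.Ioi (0:ℝ),
            Real.exp (-(r*x)) * r ^ (a-1) /
              (r ^ (2*a) + 2*κ*Real.cos (π*a) * r ^ a + κ^2)) +
        (1/x) * ∫ z in Set.Ioo (0:ℝ) x,
          ((1 - a) + (2*a*κ*Real.sin (π*a)/π) *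
            ∫ r in Set.Ioi (0:ℝ),
              Real.exp (-(r*z)) * r ^ (a-1) /
                (r ^ (2*a) + 2*κ*Real.cos (π*a) * r ^ a + κ^2))) := by
  have hπa : 0 < π * a := by positivity
  have hπa' : π * a < π := by nlinarith [pi_pos]
  have hsin : 0 < sin (π * a) := sin_pos_of_pos_of_lt_pi hπa hπa'
  have hcos : |cos (π * a)| < 1 := by
    rw [← sq_lt_one_iff_abs_lt_one]
    nlinarith [sin_sq_add_cos_sq (π * a)]
  have hK : 0 < 2*a*κ*Real.sin (π*a)/π := by positivity
  obtain ⟨hw, hpos⟩ := rpow_div_quadratic_integrableOn_and_pos ha hκ hcos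
  simp only [mul_div_assoc (Real.exp _)]
  set K := 2*a*κ*Real.sin (π*a)/π
  set w : ℝ → ℝ := fun r => r ^ (a-1) / (r ^ (2*a) + 2*κ*Real.cos (π*a) * r ^ a + κ^2)
  set v : ℝ → ℝ := fun x => (1 - a) + K * ∫ r in Set.Ioi (0:ℝ), Real.exp (-(r*x)) * w r
  have hd : ∀ x, 0 < x → HasDerivAt v
      (K * ∫ r in Set.Ioi (0:ℝ), -r * (Real.exp (-(r*x)) * w r)) x := fun x hx =>
    ((hasDerivAt_laplace hw hx).2.const_mul K).const_add (1 - a)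
  have hneg : ∀ x, 0 < x → deriv v x < 0 := fun x hx => by
    rw [(hd x hx).deriv]
    exact mul_neg_of_pos_of_neg hK (deriv_laplace_neg hw hpos hx)
  have hcont : ContinuousOn v (Set.Ioi 0) := fun x hx =>
    (hd x hx).continuousAt.continuousWithinAt
  have hanti : StrictAntiOn v (Set.Ioi 0) :=
    strictAntiOn_of_deriv_neg (convex_Ioi 0) hcont fun x hx => hneg x (by simpa using hx)
  have hbound : ∀ x, 0 < x → |v x| ≤ |1 - a| + K * ∫ r in Set.Ioi (0:ℝ), ‖w r‖ := by
    intro x hx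
    have h : ‖∫ r in Set.Ioi (0:ℝ), Real.exp (-(r*x)) * w r‖ ≤
        ∫ r in Set.Ioi (0:ℝ), ‖w r‖ := by
      refine norm_integral_le_of_norm_le hw.norm ?_
      filter_upwards [ae_restrict_mem measurableSet_Ioi] with r hr
      have hr : 0 < r := hr
      rw [norm_mul, norm_eq_abs (exp _), abs_exp]
      exact mul_le_of_le_one_left (norm_nonneg _) (exp_le_one_iff.2 (by nlinarith))
    refine (abs_add_le _ _).trans ?_
    rw [abs_mul, abs_of_pos hK]
    exact add_le_add_right (mul_le_mul_of_nonneg_left h hK.le) _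
  exact ⟨fun x hx => ⟨(hd x hx).differentiableAt, hneg x hx⟩,
    fun x hx => mul_pos_of_neg_of_neg (neg_neg_of_pos hx) (hneg x hx),
    fun x hx => lt_average_of_strictAntiOn hcont hanti hbound hx⟩
end

section
/- Let $0<a<1$ and $\kappa>0$, and let $\bar v(x)=(1-a)+\frac{2a\kappa\sin(\pi a)}{\pi}\int_0^\infty \frac{e^{-rx}\,r^{a-1}}{r^{2a}+2\kappa\cos(\pi a)\,r^{a}+\kappa^2}\,dr$ for $x>0$. Then $\lim_{x\to0^+}\bar v(x)=1+a$ and $\lim_{x\to\infty}\bar v(x)=1-a$. -/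
open MeasureTheory Real Filter

/-- The Laplace transform of an integrable function tends to its integral at `0⁺`. -/
theorem tendsto_integral_exp_neg_mul_nhdsGT_zero {f : ℝ → ℝ} (hf : IntegrableOn f (Set.Ioi 0)) :
    Tendsto (fun x : ℝ => ∫ r in Set.Ioi (0:ℝ), Real.exp (-(r*x)) * f r)
      (nhdsWithin 0 (Set.Ioi 0)) (nhds (∫ r in Set.Ioi (0:ℝ), f r)) := by
  refine tendsto_integral_filter_of_dominated_convergence (fun r => ‖f r‖) ?_ ?_ hf.norm ?_
  · exact Eventually.of_forall fun x =>
      (by fun_prop : Continuous fun r : ℝ => Real.exp (-(r*x))).aestronglyMeasurable.mul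
        hf.aestronglyMeasurable
  · filter_upwards [self_mem_nhdsWithin] with x (hx : 0 < x)
    filter_upwards [ae_restrict_mem measurableSet_Ioi] with r (hr : 0 < r)
    rw [norm_mul, Real.norm_of_nonneg (Real.exp_nonneg _)]
    exact mul_le_of_le_one_left (norm_nonneg _)
      (Real.exp_le_one_iff.2 (neg_nonpos.2 (mul_pos hr hx).le))
  · refine Eventually.of_forall fun r => Tendsto.mono_left ?_ nhdsWithin_le_nhds
    have h : Continuous fun x : ℝ => Real.exp (-(r*x)) * f r := by fun_prop
    simpa using h.tendsto 0

/-- The Laplace transform of an integrable function vanishes at infinity. -/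
theorem tendsto_integral_exp_neg_mul_atTop {f : ℝ → ℝ} (hf : IntegrableOn f (Set.Ioi 0)) :
    Tendsto (fun x : ℝ => ∫ r in Set.Ioi (0:ℝ), Real.exp (-(r*x)) * f r) atTop (nhds 0) := by
  suffices Tendsto (fun x : ℝ => ∫ r in Set.Ioi (0:ℝ), Real.exp (-(r*x)) * f r) atTop
      (nhds (∫ r in Set.Ioi (0:ℝ), (0:ℝ))) by simpa only [integral_zero] using this
  refine tendsto_integral_filter_of_dominated_convergence (fun r => ‖f r‖) ?_ ?_ hf.norm ?_
  · exact Eventually.of_forall fun x =>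
      (by fun_prop : Continuous fun r : ℝ => Real.exp (-(r*x))).aestronglyMeasurable.mul
        hf.aestronglyMeasurable
  · filter_upwards [eventually_gt_atTop 0] with x hx
    filter_upwards [ae_restrict_mem measurableSet_Ioi] with r (hr : 0 < r)
    rw [norm_mul, Real.norm_of_nonneg (Real.exp_nonneg _)]
    exact mul_le_of_le_one_left (norm_nonneg _)
      (Real.exp_le_one_iff.2 (neg_nonpos.2 (mul_pos hr hx).le))
  · filter_upwards [ae_restrict_mem measurableSet_Ioi] with r (hr : 0 < r)
    simpa using ((Real.tendsto_exp_neg_atTop_nhds_zero.comp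
      (tendsto_id.const_mul_atTop hr)).mul_const (f r))

/-- The density `r^(a-1) / |κ + e^{iπa} r^a|²` is integrable on the positive half-line, with
integral `π / (κ sin(πa))`. -/
theorem integrableOn_and_integral_rpow_div_quadratic {a κ : ℝ} (ha : 0 < a) (ha' : a < 1)
    (hκ : 0 < κ) :
    IntegrableOn (fun r : ℝ =>
        r ^ (a-1) / (r ^ (2*a) + 2*κ*Real.cos (π*a) * r ^ a + κ^2)) (Set.Ioi 0) ∧
      ∫ r in Set.Ioi (0:ℝ), r ^ (a-1) / (r ^ (2*a) + 2*κ*Real.cos (π*a) * r ^ a + κ^2) =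
        π / (κ * Real.sin (π*a)) := by
  have hs : 0 < Real.sin (π*a) :=
    Real.sin_pos_of_pos_of_lt_pi (by positivity) (by nlinarith [Real.pi_pos])
  have hsc := Real.sin_sq_add_cos_sq (π*a)
  have harctan : Real.arctan (Real.cos (π*a) / Real.sin (π*a)) = π/2 - π*a := by
    rw [← inv_div, ← Real.tan_eq_sin_div_cos, ← Real.tan_pi_div_two_sub]
    exact Real.arctan_tan (by nlinarith [Real.pi_pos]) (by nlinarith [Real.pi_pos])
  set s := Real.sin (π*a)
  set c := Real.cos (π*a)
  let G : ℝ → ℝ := fun r => Real.arctan ((r ^ a + κ*c) / (κ*s)) / (a*κ*s)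
  have hquad : ∀ r : ℝ, 0 < r →
      r ^ (2*a) + 2*κ*c * r ^ a + κ^2 = (r ^ a + κ*c)^2 + (κ*s)^2 := by
    intro r hr
    rw [mul_comm 2 a, Real.rpow_mul hr.le, Real.rpow_two]
    linear_combination -κ^2 * hsc
  have hcont : ContinuousWithinAt G (Set.Ici 0) 0 := by
    have h : Continuous fun r : ℝ => r ^ a := Real.continuous_rpow_const ha.le
    have : Continuous G := by fun_prop
    exact this.continuousWithinAt
  have hderiv : ∀ r ∈ Set.Ioi (0:ℝ),
      HasDerivAt G (r ^ (a-1) / (r ^ (2*a) + 2*κ*c * r ^ a + κ^2)) r := by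
    intro r (hr : 0 < r)
    have h := ((((Real.hasDerivAt_rpow_const (p := a) (Or.inl hr.ne')).add_const
      (κ*c)).div_const (κ*s)).arctan).div_const (a*κ*s)
    refine h.congr_deriv ?_
    rw [hquad r hr]
    have : (r ^ a + κ*c)^2 + (κ*s)^2 ≠ 0 := by positivity
    field_simp
    ring
  have hnonneg : ∀ r ∈ Set.Ioi (0:ℝ),
      0 ≤ r ^ (a-1) / (r ^ (2*a) + 2*κ*c * r ^ a + κ^2) := by
    intro r (hr : 0 < r)
    rw [hquad r hr]
    positivity
  have hlim : Tendsto G atTop (nhds (π/2 / (a*κ*s))) := by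
    refine Tendsto.div_const ?_ _
    refine (tendsto_nhds_of_tendsto_nhdsWithin Real.tendsto_arctan_atTop).comp ?_
    exact (tendsto_atTop_add_const_right _ _ (tendsto_rpow_atTop ha)).atTop_div_const
      (by positivity)
  refine ⟨integrableOn_Ioi_deriv_of_nonneg hcont hderiv hnonneg hlim, ?_⟩
  rw [integral_Ioi_of_hasDerivAt_of_nonneg hcont hderiv hnonneg hlim]
  simp only [G, Real.zero_rpow ha.ne', zero_add, mul_div_mul_left _ _ hκ.ne', harctan]
  field_simp
  ring

/-- For `0 < a < 1` and `κ > 0`, the function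
`v̄(x) = (1-a) + (2aκ sin(πa)/π) ∫_0^∞ e^{-rx} r^{a-1}/(r^{2a} + 2κ cos(πa) r^a + κ²) dr`
satisfies `v̄(x) → 1+a` as `x → 0⁺` and `v̄(x) → 1-a` as `x → ∞`. -/
theorem vbar_limits (a κ : ℝ) (ha : 0 < a) (ha' : a < 1) (hκ : 0 < κ) :
    Tendsto (fun x : ℝ => (1 - a) + (2*a*κ*Real.sin (π*a)/π) *
        ∫ r in Set.Ioi (0:ℝ),
          Real.exp (-(r*x)) * r ^ (a-1) /
            (r ^ (2*a) + 2*κ*Real.cos (π*a) * r ^ a + κ^2))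
      (nhdsWithin 0 (Set.Ioi 0)) (nhds (1 + a)) ∧
    Tendsto (fun x : ℝ => (1 - a) + (2*a*κ*Real.sin (π*a)/π) *
        ∫ r in Set.Ioi (0:ℝ),
          Real.exp (-(r*x)) * r ^ (a-1) /
            (r ^ (2*a) + 2*κ*Real.cos (π*a) * r ^ a + κ^2))
      atTop (nhds (1 - a)) := by
  obtain ⟨hint, hval⟩ := integrableOn_and_integral_rpow_div_quadratic ha ha' hκ
  have hs : 0 < Real.sin (π*a) :=
    Real.sin_pos_of_pos_of_lt_pi (by positivity) (by nlinarith [Real.pi_pos])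
  simp only [mul_div_assoc (Real.exp _)]
  constructor
  · have h := ((tendsto_integral_exp_neg_mul_nhdsGT_zero hint).const_mul
      (2*a*κ*Real.sin (π*a)/π)).const_add (1 - a)
    rw [hval] at h
    convert h using 2
    generalize Real.sin (π*a) = s at hs
    field_simp
    ring
  · simpa only [mul_zero, add_zero] using
      ((tendsto_integral_exp_neg_mul_atTop hint).const_mul
        (2*a*κ*Real.sin (π*a)/π)).const_add (1 - a)
end

section
/- Let $0<a<1$ and $\kappa>0$, and let $\bar v(x)=(1-a)+\frac{2a\kappa\sin(\pi a)}{\pi}\int_0^\infty \frac{e^{-rx}\,r^{a-1}}{r^{2a}+2\kappa\cos(\pi a)\,r^{a}+\kappa^2}\,dr$ for $x>0$. Then $\lim_{x\to0^+}x^{1-a}\,\bar v'(x)=-\frac{2a\kappa}{\Gamma(a)}$ and $\lim_{x\to\infty}x^{1+a}\,\bar v'(x)=\frac{2a}{\kappa\,\Gamma(-a)}$, where $\Gamma$ is the Gamma function (note $\Gamma(-a)<0$ for $0<a<1$). -/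
open MeasureTheory Real Filter

/-- The quadratic form `y² + 2 c cos θ y + c²` dominates `(sin θ)² c²`. -/
lemma sin_sq_mul_sq_le_quadratic (θ c y : ℝ) :
    Real.sin θ ^ 2 * c ^ 2 ≤ y ^ 2 + 2 * c * Real.cos θ * y + c ^ 2 := by
  nlinarith [sq_nonneg (y + c * Real.cos θ), Real.sin_sq_add_cos_sq θ]

lemma sin_sq_mul_sq_le_quadratic' (θ c y : ℝ) :
    Real.sin θ ^ 2 * y ^ 2 ≤ y ^ 2 + 2 * c * Real.cos θ * y + c ^ 2 := by
  nlinarith [sq_nonneg (c + y * Real.cos θ), Real.sin_sq_add_cos_sq θ]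

lemma rpow_two_mul_eq_sq {r : ℝ} (hr : 0 ≤ r) (a : ℝ) : r ^ (2 * a) = (r ^ a) ^ 2 := by
  rw [mul_comm, Real.rpow_mul hr, Real.rpow_two]

lemma integrableOn_exp_neg_mul_mul_rpow {p x : ℝ} (hp : -1 < p) (hx : 0 < x) :
    IntegrableOn (fun r : ℝ => Real.exp (-(r * x)) * r ^ p) (Set.Ioi 0) := by
  have h := integrableOn_rpow_mul_exp_neg_mul_rpow (p := 1) hp one_pos hx
  refine h.congr_fun (fun r _ => ?_) measurableSet_Ioi
  simp only [Real.rpow_one]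
  rw [mul_comm, neg_mul, mul_comm x r]

lemma integral_Ioi_exp_neg_mul_rpow_eq_Gamma {p : ℝ} (hp : -1 < p) :
    ∫ r in Set.Ioi (0:ℝ), Real.exp (-r) * r ^ p = Real.Gamma (p + 1) := by
  rw [Real.Gamma_eq_integral (by linarith)]
  simp

lemma hasDerivAt_integral_exp_neg_mul_div {a κ x : ℝ} (ha : 0 < a) (ha' : a < 1) (hκ : 0 < κ)
    (hx : 0 < x) :
    HasDerivAt (fun x : ℝ => ∫ r in Set.Ioi (0:ℝ),
        Real.exp (-(r*x)) * r ^ (a-1) /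
          (r ^ (2*a) + 2*κ*Real.cos (π*a) * r ^ a + κ^2))
      (-∫ r in Set.Ioi (0:ℝ), Real.exp (-(r*x)) * r ^ a /
          (r ^ (2*a) + 2*κ*Real.cos (π*a) * r ^ a + κ^2)) x := by
  have hs : 0 < Real.sin (π * a) :=
    Real.sin_pos_of_pos_of_lt_pi (by positivity) (by nlinarith [Real.pi_pos])
  have hm : 0 < Real.sin (π * a) ^ 2 * κ ^ 2 := by positivity
  have hD : ∀ r ∈ Set.Ioi (0:ℝ), Real.sin (π * a) ^ 2 * κ ^ 2 ≤
      r ^ (2*a) + 2*κ*Real.cos (π*a) * r ^ a + κ^2 := fun r hr => by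
    rw [rpow_two_mul_eq_sq (le_of_lt hr)]
    exact sin_sq_mul_sq_le_quadratic _ _ _
  rw [← integral_neg]
  refine (hasDerivAt_integral_of_dominated_loc_of_deriv_le
    (F := fun x r => Real.exp (-(r*x)) * r ^ (a-1) /
      (r ^ (2*a) + 2*κ*Real.cos (π*a) * r ^ a + κ^2))
    (F' := fun x r => -(Real.exp (-(r*x)) * r ^ a /
      (r ^ (2*a) + 2*κ*Real.cos (π*a) * r ^ a + κ^2)))
    (bound := fun r => Real.exp (-(r*(x/2))) * r ^ a / (Real.sin (π * a) ^ 2 * κ ^ 2))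
    (Ioi_mem_nhds (half_lt_self hx)) ?_ ?_ ?_ ?_ ?_ ?_).2
  · exact Eventually.of_forall fun y => (by fun_prop : Measurable _).aestronglyMeasurable
  · refine ((integrableOn_exp_neg_mul_mul_rpow (p := a - 1) (by linarith) hx).div_const
      (Real.sin (π * a) ^ 2 * κ ^ 2)).mono'
      (by fun_prop : Measurable _).aestronglyMeasurable ?_
    filter_upwards [ae_restrict_mem measurableSet_Ioi] with r hr
    have h := hD r hr
    have hr0 : 0 < r := hr
    rw [Real.norm_of_nonneg (by have := hm.trans_le h; positivity)]
    gcongr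
  · exact (by fun_prop : Measurable _).aestronglyMeasurable
  · filter_upwards [ae_restrict_mem measurableSet_Ioi] with r hr y hy
    have h := hD r hr
    have hr0 : 0 < r := hr
    have hy' : x / 2 < y := hy
    rw [norm_neg, Real.norm_of_nonneg (by have := hm.trans_le h; positivity)]
    gcongr
  · exact (integrableOn_exp_neg_mul_mul_rpow (by linarith) (half_pos hx)).div_const _
  · filter_upwards [ae_restrict_mem measurableSet_Ioi] with r hr y _
    have hr0 : 0 < r := hr
    have h1 : HasDerivAt (fun y : ℝ => Real.exp (-(r*y))) (Real.exp (-(r*y)) * (-r)) y := by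
      simpa using (((hasDerivAt_id y).const_mul r).neg).exp
    have h2 := (h1.mul_const (r ^ (a-1))).div_const
      (r ^ (2*a) + 2*κ*Real.cos (π*a) * r ^ a + κ^2)
    refine h2.congr_deriv ?_
    rw [Real.rpow_sub_one hr0.ne']
    field_simp

lemma integral_Ioi_eq_inv_mul_integral_div (g : ℝ → ℝ) {x : ℝ} (hx : 0 < x) :
    ∫ r in Set.Ioi (0:ℝ), g r = x⁻¹ * ∫ s in Set.Ioi (0:ℝ), g (s / x) := by
  have h := integral_comp_mul_left_Ioi g 0 (inv_pos.2 hx)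
  simp only [mul_zero, inv_inv, smul_eq_mul] at h
  simp only [div_eq_inv_mul, h]
  field_simp

lemma tendsto_rpow_mul_integral_atTop {a κ : ℝ} (ha : 0 < a) (ha' : a < 1) (hκ : 0 < κ) :
    Tendsto (fun x : ℝ => x ^ (1+a) * ∫ r in Set.Ioi (0:ℝ), Real.exp (-(r*x)) * r ^ a /
          (r ^ (2*a) + 2*κ*Real.cos (π*a) * r ^ a + κ^2))
      atTop (nhds (Real.Gamma (a + 1) / κ ^ 2)) := by
  have hs : 0 < Real.sin (π * a) :=
    Real.sin_pos_of_pos_of_lt_pi (by positivity) (by nlinarith [Real.pi_pos])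
  have hm : 0 < Real.sin (π * a) ^ 2 * κ ^ 2 := by positivity
  have key : Tendsto (fun x : ℝ => ∫ s in Set.Ioi (0:ℝ), Real.exp (-s) * s ^ a /
      (((s / x) ^ a) ^ 2 + 2*κ*Real.cos (π*a) * (s / x) ^ a + κ^2)) atTop
      (nhds (∫ s in Set.Ioi (0:ℝ), Real.exp (-s) * s ^ a / κ ^ 2)) := by
    refine tendsto_integral_filter_of_dominated_convergence
      (fun s => Real.exp (-s) * s ^ a / (Real.sin (π * a) ^ 2 * κ ^ 2)) ?_ ?_ ?_ ?_
    · exact Eventually.of_forall fun y => (by fun_prop : Measurable _).aestronglyMeasurable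
    · refine Eventually.of_forall fun y => ?_
      filter_upwards [ae_restrict_mem measurableSet_Ioi] with s hs
      have hs0 : 0 < s := hs
      have h := sin_sq_mul_sq_le_quadratic (π * a) κ ((s / y) ^ a)
      rw [Real.norm_of_nonneg (by have := hm.trans_le h; positivity)]
      gcongr
    · simpa using (integrableOn_exp_neg_mul_mul_rpow (p := a) (by linarith) one_pos).div_const
        (Real.sin (π * a) ^ 2 * κ ^ 2)
    · refine Eventually.of_forall fun s => ?_
      have h0 : Tendsto (fun x : ℝ => (s / x) ^ a) atTop (nhds 0) := by
        have := (tendsto_const_nhds (x := s)).div_atTop tendsto_id |>.rpow_const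
          (p := a) (Or.inr ha.le)
        simpa [Real.zero_rpow ha.ne'] using this
      have h1 := ((h0.pow 2).add (h0.const_mul (2*κ*Real.cos (π*a)))).add_const (κ ^ 2)
      refine Tendsto.div tendsto_const_nhds (by simpa using h1) (by positivity)
  rw [integral_div, integral_Ioi_exp_neg_mul_rpow_eq_Gamma (by linarith)] at key
  refine key.congr' ?_
  filter_upwards [eventually_gt_atTop 0] with x hx
  symm
  rw [integral_Ioi_eq_inv_mul_integral_div _ hx, ← mul_assoc, ← integral_const_mul]
  refine setIntegral_congr_fun measurableSet_Ioi fun s hs => ?_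
  have hs0 : 0 < s := hs
  have hx' := (Real.rpow_pos_of_pos hx a).ne'
  rw [rpow_two_mul_eq_sq (div_pos hs0 hx).le, div_mul_cancel₀ _ hx.ne', Real.rpow_add hx,
    Real.rpow_one]
  have e : s ^ a = x ^ a * (s / x) ^ a := by
    rw [← Real.mul_rpow hx.le (div_pos hs0 hx).le, mul_div_cancel₀ _ hx.ne']
  rw [e]
  field_simp

lemma tendsto_rpow_mul_integral_zero {a : ℝ} (κ : ℝ) (ha : 0 < a) (ha' : a < 1) :
    Tendsto (fun x : ℝ => x ^ (1-a) * ∫ r in Set.Ioi (0:ℝ), Real.exp (-(r*x)) * r ^ a /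
          (r ^ (2*a) + 2*κ*Real.cos (π*a) * r ^ a + κ^2))
      (nhdsWithin 0 (Set.Ioi 0)) (nhds (Real.Gamma (1 - a))) := by
  have hs : 0 < Real.sin (π * a) :=
    Real.sin_pos_of_pos_of_lt_pi (by positivity) (by nlinarith [Real.pi_pos])
  have key : Tendsto (fun x : ℝ => ∫ s in Set.Ioi (0:ℝ), Real.exp (-s) * s ^ a /
      ((s ^ a) ^ 2 + 2*(κ * x ^ a)*Real.cos (π*a) * s ^ a + (κ * x ^ a)^2))
      (nhdsWithin 0 (Set.Ioi 0))
      (nhds (∫ s in Set.Ioi (0:ℝ), Real.exp (-s) * s ^ (-a))) := by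
    refine tendsto_integral_filter_of_dominated_convergence
      (fun s => Real.exp (-s) * s ^ (-a) / Real.sin (π * a) ^ 2) ?_ ?_ ?_ ?_
    · exact Eventually.of_forall fun y => (by fun_prop : Measurable _).aestronglyMeasurable
    · refine Eventually.of_forall fun y => ?_
      filter_upwards [ae_restrict_mem measurableSet_Ioi] with s hs
      have hs0 : 0 < s := hs
      have hp := Real.rpow_pos_of_pos hs0 a
      have h := sin_sq_mul_sq_le_quadratic' (π * a) (κ * y ^ a) (s ^ a)
      have hm : 0 < Real.sin (π * a) ^ 2 * (s ^ a) ^ 2 := by positivity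
      rw [Real.norm_of_nonneg (by have := hm.trans_le h; positivity)]
      calc _ ≤ Real.exp (-s) * s ^ a / (Real.sin (π * a) ^ 2 * (s ^ a) ^ 2) := by gcongr
        _ = _ := by
          rw [Real.rpow_neg hs0.le]
          field_simp
    · simpa using (integrableOn_exp_neg_mul_mul_rpow (p := -a) (by linarith) one_pos).div_const
        (Real.sin (π * a) ^ 2)
    · filter_upwards [ae_restrict_mem measurableSet_Ioi] with s hs
      have hs0 : 0 < s := hs
      have hp := Real.rpow_pos_of_pos hs0 a
      have h0 : Tendsto (fun x : ℝ => κ * x ^ a) (nhdsWithin 0 (Set.Ioi 0)) (nhds 0) := by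
        have := ((Real.continuousAt_rpow_const 0 a (Or.inr ha.le)).tendsto.const_mul κ).mono_left
          (nhdsWithin_le_nhds (s := Set.Ioi (0:ℝ)))
        simpa [Real.zero_rpow ha.ne'] using this
      have h1 := (((h0.const_mul 2).mul_const (Real.cos (π*a))).mul_const (s ^ a)
        |>.const_add ((s ^ a) ^ 2)).add (h0.pow 2)
      have h2 := (tendsto_const_nhds (x := Real.exp (-s) * s ^ a)).div h1
        (by simpa using hp.ne')
      have e : Real.exp (-s) * s ^ (-a) = Real.exp (-s) * s ^ a /
          ((s ^ a) ^ 2 + 2 * 0 * Real.cos (π*a) * s ^ a + 0 ^ 2) := by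
        rw [Real.rpow_neg hs0.le]
        field_simp
        ring
      rw [e]
      exact h2
  rw [integral_Ioi_exp_neg_mul_rpow_eq_Gamma (by linarith), neg_add_eq_sub] at key
  refine key.congr' ?_
  filter_upwards [self_mem_nhdsWithin] with x hx
  have hx : 0 < x := hx
  symm
  rw [integral_Ioi_eq_inv_mul_integral_div _ hx, ← mul_assoc, ← integral_const_mul]
  refine setIntegral_congr_fun measurableSet_Ioi fun s hs => ?_
  have hs0 : 0 < s := hs
  have hx' := (Real.rpow_pos_of_pos hx a).ne'
  rw [rpow_two_mul_eq_sq (div_pos hs0 hx).le, div_mul_cancel₀ _ hx.ne', Real.rpow_sub hx,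
    Real.rpow_one]
  have e : s ^ a = x ^ a * (s / x) ^ a := by
    rw [← Real.mul_rpow hx.le (div_pos hs0 hx).le, mul_div_cancel₀ _ hx.ne']
  rw [e, show (x ^ a * (s / x) ^ a) ^ 2 +
      2 * (κ * x ^ a) * Real.cos (π*a) * (x ^ a * (s / x) ^ a) + (κ * x ^ a) ^ 2 =
      (x ^ a) ^ 2 * (((s / x) ^ a) ^ 2 + 2*κ*Real.cos (π*a) * (s / x) ^ a + κ^2) by ring]
  field_simp

lemma Real.Gamma_neg_mul_Gamma_add_one {a : ℝ} (ha : a ≠ 0) :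
    Real.Gamma (-a) * Real.Gamma (a + 1) = -(π / Real.sin (π * a)) := by
  have h := Real.Gamma_mul_Gamma_one_sub a
  rw [← h, Real.Gamma_add_one ha, show 1 - a = -a + 1 by ring,
    Real.Gamma_add_one (neg_ne_zero.2 ha)]
  ring

/-- For `0 < a < 1` and `κ > 0`, the function
`v̄(x) = (1-a) + (2aκ sin(πa)/π) ∫_0^∞ e^{-rx} r^{a-1}/(r^{2a} + 2κ cos(πa) r^a + κ²) dr`
satisfies `x^{1-a} v̄'(x) → -2aκ/Γ(a)` as `x → 0⁺` and
`x^{1+a} v̄'(x) → 2a/(κ Γ(-a))` as `x → ∞`. -/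
theorem vbar_deriv_asymptotics (a κ : ℝ) (ha : 0 < a) (ha' : a < 1) (hκ : 0 < κ) :
    Tendsto (fun x : ℝ => x ^ (1-a) *
        deriv (fun x : ℝ => (1 - a) + (2*a*κ*Real.sin (π*a)/π) *
          ∫ r in Set.Ioi (0:ℝ),
            Real.exp (-(r*x)) * r ^ (a-1) /
              (r ^ (2*a) + 2*κ*Real.cos (π*a) * r ^ a + κ^2)) x)
      (nhdsWithin 0 (Set.Ioi 0)) (nhds (-(2*a*κ) / Real.Gamma a)) ∧
    Tendsto (fun x : ℝ => x ^ (1+a) *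
        deriv (fun x : ℝ => (1 - a) + (2*a*κ*Real.sin (π*a)/π) *
          ∫ r in Set.Ioi (0:ℝ),
            Real.exp (-(r*x)) * r ^ (a-1) /
              (r ^ (2*a) + 2*κ*Real.cos (π*a) * r ^ a + κ^2)) x)
      atTop (nhds (2*a / (κ * Real.Gamma (-a)))) := by
  have hs : 0 < Real.sin (π * a) :=
    Real.sin_pos_of_pos_of_lt_pi (by positivity) (by nlinarith [Real.pi_pos])
  have hd : ∀ x : ℝ, 0 < x → deriv (fun x : ℝ => (1 - a) + (2*a*κ*Real.sin (π*a)/π) *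
      ∫ r in Set.Ioi (0:ℝ), Real.exp (-(r*x)) * r ^ (a-1) /
        (r ^ (2*a) + 2*κ*Real.cos (π*a) * r ^ a + κ^2)) x =
      (2*a*κ*Real.sin (π*a)/π) * -∫ r in Set.Ioi (0:ℝ), Real.exp (-(r*x)) * r ^ a /
        (r ^ (2*a) + 2*κ*Real.cos (π*a) * r ^ a + κ^2) := fun x hx =>
    (((hasDerivAt_integral_exp_neg_mul_div ha ha' hκ hx).const_mul _).const_add _).deriv
  have hG := Real.Gamma_pos_of_pos ha
  constructor
  · have h := (tendsto_rpow_mul_integral_zero κ ha ha').const_mul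
      (-(2*a*κ*Real.sin (π*a)/π))
    have e : -(2*a*κ*Real.sin (π*a)/π) * Real.Gamma (1 - a) = -(2*a*κ) / Real.Gamma a := by
      have h := Real.Gamma_mul_Gamma_one_sub a
      have h' : Real.Gamma (1 - a) = π / Real.sin (π * a) / Real.Gamma a := by
        rw [← h]; field_simp
      rw [h']
      generalize Real.sin (π * a) = t at hs ⊢
      field_simp
    rw [e] at h
    refine h.congr' ?_
    filter_upwards [self_mem_nhdsWithin] with x hx
    rw [hd x hx]
    ring
  · have h := (tendsto_rpow_mul_integral_atTop ha ha' hκ).const_mul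
      (-(2*a*κ*Real.sin (π*a)/π))
    have e : -(2*a*κ*Real.sin (π*a)/π) * (Real.Gamma (a + 1) / κ ^ 2) =
        2*a / (κ * Real.Gamma (-a)) := by
      have h := Real.Gamma_neg_mul_Gamma_add_one ha.ne'
      have hG1 : Real.Gamma (a + 1) ≠ 0 := (Real.Gamma_pos_of_pos (by linarith)).ne'
      have h' : Real.Gamma (-a) = -(π / Real.sin (π * a)) / Real.Gamma (a + 1) := by
        rw [← h]; field_simp
      rw [h']
      field_simp
    rw [e] at h
    refine h.congr' ?_
    filter_upwards [eventually_gt_atTop 0] with x hx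
    rw [hd x hx]
    ring
end

section
/- For every $a\in(0,1)$ there exists a unique $F(a)>0$ such that $\log(1+F(a))-F(a)=\log(1-a)+a$, and the function $F$ so defined satisfies the asymptotics $\lim_{a\to0^+}\frac{F(a)-a}{a^{2}}=\frac{2}{3}$. -/
open Filter

lemma strictAntiOn_log_one_add_sub :
    StrictAntiOn (fun t : ℝ => Real.log (1 + t) - t) (Set.Ici 0) := by
  intro s hs t _ hst
  have hs : 0 ≤ s := hs
  have h1 : 0 < 1 + s := by linarith
  have h2 : 0 < 1 + t := by linarith
  have h := Real.log_lt_sub_one_of_pos (div_pos h2 h1)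
    (by rw [ne_eq, div_eq_one_iff_eq h1.ne']; linarith)
  rw [Real.log_div h2.ne' h1.ne'] at h
  have h3 : (1 + t) / (1 + s) - 1 ≤ t - s := by
    rw [div_sub_one h1.ne', div_le_iff₀ h1]
    nlinarith
  change Real.log (1 + t) - t < Real.log (1 + s) - s
  linarith

lemma exists_log_one_add_sub_eq {y : ℝ} (hy : y < 0) :
    ∃ t : ℝ, 0 < t ∧ Real.log (1 + t) - t = y := by
  have hT : (0:ℝ) ≤ (2 - y) ^ 2 - 1 := by nlinarith
  have hcont : ContinuousOn (fun t : ℝ => Real.log (1 + t) - t)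
      (Set.Icc 0 ((2 - y) ^ 2 - 1)) := by
    refine ContinuousOn.sub (ContinuousOn.log (by fun_prop) ?_) continuousOn_id
    intro t ht
    have := ht.1
    positivity
  have hend : Real.log (1 + ((2 - y) ^ 2 - 1)) - ((2 - y) ^ 2 - 1) ≤ y := by
    rw [add_sub_cancel, Real.log_pow]
    have := Real.log_le_sub_one_of_pos (show 0 < 2 - y by linarith)
    push_cast
    nlinarith
  obtain ⟨t, ht, hty⟩ := intermediate_value_Icc' hT hcont
    (show y ∈ Set.Icc _ _ from ⟨hend, by simpa using hy.le⟩)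
  refine ⟨t, lt_of_le_of_ne ht.1 ?_, hty⟩
  rintro rfl
  simp at hty
  linarith

lemma log_one_sub_add_neg {a : ℝ} (ha : a ∈ Set.Ioo (0:ℝ) 1) : Real.log (1 - a) + a < 0 := by
  have := Real.log_lt_sub_one_of_pos (show 0 < 1 - a by linarith [ha.2]) (by linarith [ha.1])
  linarith

/-- The difference of the values of `log (1 + t) - t` at `t = x + c x²` and at `t = -x`. -/
noncomputable def logDefect (c x : ℝ) : ℝ :=
  Real.log (1 + (x + c * x ^ 2)) - (x + c * x ^ 2) - (Real.log (1 - x) + x)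

lemma logDefect_zero (c : ℝ) : logDefect c 0 = 0 := by simp [logDefect]

lemma hasDerivAt_logDefect {c x : ℝ} (hc : 0 ≤ c) (hx : x ∈ Set.Ico (0:ℝ) 1) :
    HasDerivAt (logDefect c)
      (x ^ 2 * (2 - 3 * c + (4 * c - 2 * c ^ 2) * x + 2 * c ^ 2 * x ^ 2) /
        ((1 + (x + c * x ^ 2)) * (1 - x))) x := by
  have hx0 := hx.1
  have h1 : 1 + (x + c * x ^ 2) ≠ 0 := by positivity
  have h2 : 1 - x ≠ 0 := by linarith [hx.2]
  have hq : HasDerivAt (fun x : ℝ => x + c * x ^ 2) (1 + c * (2 * x)) x :=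
    ((hasDerivAt_id' x).add ((hasDerivAt_pow 2 x).const_mul c)).congr_deriv (by simp)
  have h := (((hq.const_add 1).log h1).sub hq).sub
    ((((hasDerivAt_id x).const_sub 1).log h2).add (hasDerivAt_id x))
  refine h.congr_deriv ?_
  simp only [id]
  field_simp
  ring

lemma logDefect_nonneg {a : ℝ} (ha : a ∈ Set.Ioo (0:ℝ) 1) : 0 ≤ logDefect (2 / 3) a := by
  have hd : ∀ x ∈ Set.Icc 0 a, _ := fun x hx =>
    hasDerivAt_logDefect (c := 2 / 3) (by norm_num) ⟨hx.1, hx.2.trans_lt ha.2⟩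
  have hmono : MonotoneOn (logDefect (2 / 3)) (Set.Icc 0 a) := by
    refine monotoneOn_of_deriv_nonneg (convex_Icc 0 a)
      (fun x hx => (hd x hx).continuousAt.continuousWithinAt)
      (fun x hx => (hd x (interior_subset hx)).differentiableAt.differentiableWithinAt) ?_
    intro x hx
    have hx := interior_subset hx
    rw [(hd x hx).deriv]
    have hx0 := hx.1
    have hx1 : 0 ≤ 1 - x := by linarith [hx.2, ha.2]
    norm_num
    positivity
  simpa only [logDefect_zero] using
    hmono (Set.left_mem_Icc.2 ha.1.le) (Set.right_mem_Icc.2 ha.1.le) ha.1.le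

lemma logDefect_nonpos {a : ℝ} (ha : a ∈ Set.Ioo (0:ℝ) (1 / 4)) :
    logDefect (2 / 3 + 4 / 3 * a) a ≤ 0 := by
  have ha0 := ha.1
  have ha1 := ha.2
  obtain ⟨c, hc⟩ : ∃ c, c = 2 / 3 + 4 / 3 * a := ⟨_, rfl⟩
  rw [← hc]
  have hc0 : 0 ≤ c := by linarith
  have hc1 : c ≤ 1 := by linarith
  have hd : ∀ x ∈ Set.Icc 0 a, _ := fun x hx =>
    hasDerivAt_logDefect hc0 ⟨hx.1, by linarith [hx.2]⟩
  have hanti : AntitoneOn (logDefect c) (Set.Icc 0 a) := by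
    refine antitoneOn_of_deriv_nonpos (convex_Icc 0 a)
      (fun x hx => (hd x hx).continuousAt.continuousWithinAt)
      (fun x hx => (hd x (interior_subset hx)).differentiableAt.differentiableWithinAt) ?_
    intro x hx
    have hx := interior_subset hx
    rw [(hd x hx).deriv]
    have hx0 := hx.1
    have hx1 : 0 ≤ 1 - x := by linarith [hx.2]
    refine div_nonpos_of_nonpos_of_nonneg
      (mul_nonpos_of_nonneg_of_nonpos (sq_nonneg x) ?_) (by positivity)
    have h1 : (4 * c - 2 * c ^ 2) * x ≤ 2 * x :=
      mul_le_mul_of_nonneg_right (by nlinarith [sq_nonneg (c - 1)]) hx0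
    have h2 : 2 * c ^ 2 * x ^ 2 ≤ 2 * x := by
      have hcs : c ^ 2 ≤ 1 := pow_le_one₀ hc0 hc1
      have hxs : x ^ 2 ≤ x := by nlinarith
      nlinarith [sq_nonneg x]
    linarith [hx.2]
  simpa only [logDefect_zero] using
    hanti (Set.left_mem_Icc.2 ha0.le) (Set.right_mem_Icc.2 ha0.le) ha0.le

/-- For every `a ∈ (0,1)` there is a unique `F(a) > 0` with
`log(1+F(a)) - F(a) = log(1-a) + a`, and the function `F` so defined satisfies
`(F(a) - a)/a² → 2/3` as `a → 0⁺`. -/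
theorem next_amplitude_asymptotics :
    ∃ F : ℝ → ℝ,
      (∀ a ∈ Set.Ioo (0:ℝ) 1,
        (0 < F a ∧ Real.log (1 + F a) - F a = Real.log (1 - a) + a) ∧
        ∀ t : ℝ, 0 < t → Real.log (1 + t) - t = Real.log (1 - a) + a → t = F a) ∧
      Tendsto (fun a : ℝ => (F a - a) / a ^ 2)
        (nhdsWithin 0 (Set.Ioi 0)) (nhds (2/3)) := by
  choose! F hF using fun (a : ℝ) (ha : a ∈ Set.Ioo (0:ℝ) 1) =>
    exists_log_one_add_sub_eq (log_one_sub_add_neg ha)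
  refine ⟨F, fun a ha => ⟨hF a ha, fun t ht hta => ?_⟩, ?_⟩
  · exact strictAntiOn_log_one_add_sub.injOn ht.le (hF a ha).1.le (hta.trans (hF a ha).2.symm)
  have hlim : Tendsto (fun a : ℝ => 2 / 3 + 4 / 3 * a) (nhdsWithin 0 (Set.Ioi 0))
      (nhds (2 / 3)) := by
    have : Continuous fun a : ℝ => 2 / 3 + 4 / 3 * a := by fun_prop
    simpa using (this.tendsto 0).mono_left nhdsWithin_le_nhds
  have hsmall : ∀ᶠ a : ℝ in nhdsWithin 0 (Set.Ioi 0), a ∈ Set.Ioo (0:ℝ) (1 / 4) :=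
    Ioo_mem_nhdsGT (by norm_num)
  refine tendsto_of_tendsto_of_tendsto_of_le_of_le' tendsto_const_nhds hlim ?_ ?_
  · filter_upwards [hsmall] with a ha
    have ha' : a ∈ Set.Ioo (0:ℝ) 1 := ⟨ha.1, by linarith [ha.2]⟩
    have ha0 := ha.1
    have hmem : (0:ℝ) ≤ a + 2 / 3 * a ^ 2 := by positivity
    have hle : a + 2 / 3 * a ^ 2 ≤ F a := by
      refine (strictAntiOn_log_one_add_sub.le_iff_ge (hF a ha').1.le hmem).1 ?_
      have := logDefect_nonneg ha'
      rw [logDefect] at this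
      linarith [(hF a ha').2]
    rw [le_div_iff₀ (by positivity)]
    linarith
  · filter_upwards [hsmall] with a ha
    have ha' : a ∈ Set.Ioo (0:ℝ) 1 := ⟨ha.1, by linarith [ha.2]⟩
    have ha0 := ha.1
    have hmem : (0:ℝ) ≤ a + (2 / 3 + 4 / 3 * a) * a ^ 2 := by positivity
    have hle : F a ≤ a + (2 / 3 + 4 / 3 * a) * a ^ 2 := by
      refine (strictAntiOn_log_one_add_sub.le_iff_ge hmem (hF a ha').1.le).1 ?_
      have := logDefect_nonpos ha
      rw [logDefect] at this
      linarith [(hF a ha').2]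
    rw [div_le_iff₀ (by positivity)]
    linarith
end
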